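/- arXiv:1305.7004 — 3 statements merged into one kernel-verified Lean document; each statement's English description precedes it below -/
import Mathlib

section
/- Let R be a commutative Noetherian ring, S a multiplicatively closed subset, a an ideal, M a finitely generated R-module, and t a nonnegative integer. If for all i ≤ t and all primes p with p ∩ S = ∅ the R_p-module (H^i_a(M))_p is finitely generated, then S^{-1}H^i_a(M) is a finitely generated S^{-1}R-module for all i ≤ t. -/
open CategoryTheory

universe u

/-- An `R`-module `M` is *in dimension `< n`* if there is a finitely generated submodule `N`
of `M` such that the Krull dimension of `Supp (M/N)` is `< n`. -/
def InDimLT (R : Type u) [CommRing R] (M : Type u) [AddCommGroup M] [Module R M]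
    (n : ℕ) : Prop :=
  ∃ N : Submodule R M, N.FG ∧
    Order.krullDim (Module.support R (M ⧸ N)) < (n : WithBot ℕ∞)

/-- `f_a(M)`: the least `i` such that `H^i_a(M)` is not finitely generated (`⊤` if none). -/
noncomputable def fDim (R : Type u) [CommRing R] (a : Ideal R)
    (M : Type u) [AddCommGroup M] [Module R M] : ℕ∞ :=
  sInf {i : ℕ∞ | ∃ j : ℕ, i = j ∧
    ¬ Module.Finite R ((localCohomology a j).obj (ModuleCat.of R M))}

/-- `f^n_a(M) = inf { f_{aR_p}(M_p) : p ∈ Supp(M/aM), dim R/p ≥ n }`. -/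
noncomputable def fDimN (R : Type u) [CommRing R] (a : Ideal R)
    (M : Type u) [AddCommGroup M] [Module R M] (n : ℕ) : ℕ∞ :=
  sInf {i : ℕ∞ | ∃ p : PrimeSpectrum R,
    p ∈ Module.support R (M ⧸ (a • ⊤ : Submodule R M)) ∧
    (n : WithBot ℕ∞) ≤ ringKrullDim (R ⧸ p.asIdeal) ∧
    i = fDim (Localization.AtPrime p.asIdeal)
          (a.map (algebraMap R (Localization.AtPrime p.asIdeal)))
          (LocalizedModule p.asIdeal.primeCompl M)}

/-- `h^n_a(M)`: the least `i` such that `H^i_a(M)` is not in dimension `< n` (`⊤` if none). -/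
noncomputable def hDim (R : Type u) [CommRing R] (a : Ideal R)
    (M : Type u) [AddCommGroup M] [Module R M] (n : ℕ) : ℕ∞ :=
  sInf {i : ℕ∞ | ∃ j : ℕ, i = j ∧
    ¬ InDimLT R ((localCohomology a j).obj (ModuleCat.of R M)) n}

/-- A module is `S`-finite if it has a finitely generated submodule into which every element is
moved by some element of `S`. -/
def SFinite {R : Type*} [CommRing R] (S : Submonoid R) (N : Type*) [AddCommGroup N]
    [Module R N] : Prop :=
  ∃ N' : Submodule R N, N'.FG ∧ ∀ x, ∃ s ∈ S, s • x ∈ N'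

section SFinite

variable {R : Type*} [CommRing R] {S : Submonoid R}
variable {A B C : Type*} [AddCommGroup A] [Module R A] [AddCommGroup B] [Module R B]
  [AddCommGroup C] [Module R C]

theorem SFinite.of_finite (S : Submonoid R) [Module.Finite R A] : SFinite S A :=
  ⟨⊤, Module.Finite.fg_top, fun _ => ⟨1, S.one_mem, trivial⟩⟩

theorem SFinite.of_surjective (hA : SFinite S A) (f : A →ₗ[R] B) (hf : Function.Surjective f) :
    SFinite S B := by
  obtain ⟨A', hA', h⟩ := hA
  refine ⟨A'.map f, hA'.map f, fun y => ?_⟩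
  obtain ⟨x, rfl⟩ := hf y
  obtain ⟨s, hs, hx⟩ := h x
  exact ⟨s, hs, s • x, hx, map_smul f s x⟩

theorem SFinite.of_injective [IsNoetherianRing R] (hB : SFinite S B) (f : A →ₗ[R] B)
    (hf : Function.Injective f) : SFinite S A := by
  obtain ⟨B', hB', h⟩ := hB
  have : Module.Finite R B' := .of_fg hB'
  have : Module.Finite R (B'.comap f) :=
    Module.Finite.of_injective (f.restrict (p := B'.comap f) (q := B') fun _ hx => hx)
      fun x y hxy => Subtype.ext (hf (congrArg Subtype.val hxy))
  refine ⟨B'.comap f, Module.Finite.iff_fg.1 this, fun x => ?_⟩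
  obtain ⟨s, hs, hx⟩ := h (f x)
  exact ⟨s, hs, by simpa using hx⟩

theorem SFinite.of_exact [IsNoetherianRing R] (hA : SFinite S A) (hC : SFinite S C)
    (f : A →ₗ[R] B) (g : B →ₗ[R] C) (hfg : ∀ y, g y = 0 → ∃ x, f x = y) : SFinite S B := by
  obtain ⟨A', hA', h⟩ := hA
  obtain ⟨C', hC', h'⟩ := hC.of_injective (LinearMap.range g).subtype Subtype.val_injective
  obtain ⟨D, hD, rfl⟩ : ∃ D : Submodule R B, D.FG ∧ D.map g.rangeRestrict = C' := by
    classical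
    obtain ⟨T, rfl⟩ := hC'
    let v := Function.surjInv g.surjective_rangeRestrict
    refine ⟨_, ⟨T.image v, rfl⟩, ?_⟩
    rw [Submodule.map_span, Finset.coe_image, ← Set.image_comp,
      (Function.rightInverse_surjInv g.surjective_rangeRestrict).comp_eq_id, Set.image_id]
  refine ⟨A'.map f ⊔ D, (hA'.map f).sup hD, fun y => ?_⟩
  obtain ⟨s, hs, d, hd, hds⟩ := h' (g.rangeRestrict y)
  obtain ⟨x, hx⟩ := hfg (s • y - d) (by
    have := congrArg Subtype.val hds
    simp at this
    simp [this])
  obtain ⟨s', hs', hx'⟩ := h x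
  refine ⟨s' * s, mul_mem hs' hs, ?_⟩
  have : (s' * s) • y = f (s' • x) + s' • d := by
    rw [map_smul, hx, smul_sub, mul_smul]; abel
  rw [this]
  exact add_mem (Submodule.mem_sup_left ⟨_, hx', rfl⟩) (Submodule.mem_sup_right (D.smul_mem _ hd))

theorem SFinite.submodule_mono [IsNoetherianRing R] {N N' : Submodule R A} (h : SFinite S N')
    (hN : N ≤ N') : SFinite S N :=
  h.of_injective (Submodule.inclusion hN) (Submodule.inclusion_injective hN)

theorem SFinite.pi [IsNoetherianRing R] (hA : SFinite S A) (n : ℕ) : SFinite S (Fin n → A) := by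
  induction n with
  | zero => exact .of_finite S
  | succ n ih =>
    refine ih.of_exact hA (LinearMap.pi (Fin.cases 0 fun i => LinearMap.proj i)) (LinearMap.proj 0)
      fun y hy => ⟨fun i => y i.succ, ?_⟩
    ext i
    cases i using Fin.cases with
    | zero => simpa using hy.symm
    | succ i => simp

/-- The elements of a module that an ideal multiplies into a given submodule. -/
def Submodule.idealColon (N : Submodule R A) (J : Ideal R) : Submodule R A where
  carrier := {x | ∀ r ∈ J, r • x ∈ N}
  add_mem' hx hy r hr := by rw [smul_add]; exact add_mem (hx r hr) (hy r hr)
  zero_mem' r _ := by simp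
  smul_mem' c x hx r hr := by rw [smul_comm]; exact N.smul_mem c (hx r hr)

theorem Submodule.mem_idealColon_span {N : Submodule R A} {T : Set R} {x : A} :
    x ∈ N.idealColon (Ideal.span T) ↔ ∀ r ∈ T, r • x ∈ N := by
  refine ⟨fun h r hr => h r (Ideal.subset_span hr), fun h r hr => ?_⟩
  have : Ideal.span T ≤ N.comap (LinearMap.toSpanSingleton R A x) := Ideal.span_le.2 h
  exact this hr

theorem SFinite.idealColon [IsNoetherianRing R] {N : Submodule R A} {J : Ideal R}
    (hN : SFinite S N) (h0 : SFinite S ((⊥ : Submodule R A).idealColon J)) :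
    SFinite S (N.idealColon J) := by
  obtain ⟨n, v, rfl⟩ := Submodule.fg_iff_exists_fin_generating_family.1 (IsNoetherian.noetherian J)
  have hle : (⊥ : Submodule R A).idealColon (Submodule.span R (Set.range v)) ≤
      N.idealColon (Submodule.span R (Set.range v)) :=
    fun x hx r hr => by rw [(Submodule.mem_bot R).1 (hx r hr)]; exact N.zero_mem
  refine h0.of_exact (hN.pi n) (Submodule.inclusion hle)
    (LinearMap.pi fun i => (v i • Submodule.subtype _).codRestrict N
      fun x => x.2 _ (Submodule.subset_span ⟨i, rfl⟩)) fun y hy => ⟨⟨y, ?_⟩, rfl⟩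
  refine Submodule.mem_idealColon_span.2 ?_
  rintro _ ⟨i, rfl⟩
  exact congrArg Subtype.val (congrFun hy i)

theorem SFinite.idealColon_pow [IsNoetherianRing R] {J : Ideal R}
    (h : SFinite S ((⊥ : Submodule R A).idealColon J)) (n : ℕ) :
    SFinite S ((⊥ : Submodule R A).idealColon (J ^ n)) := by
  induction n with
  | zero =>
    refine h.submodule_mono fun x hx r _ => ?_
    have := hx 1 (by simp)
    simp_all
  | succ n ih =>
    refine (SFinite.idealColon ih h).submodule_mono fun x hx r hr r' hr' => ?_
    rw [smul_smul]
    exact hx _ (pow_succ J n ▸ Ideal.mul_mem_mul hr' hr)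

theorem SFinite.module_finite_localizedModule (h : SFinite S A) :
    Module.Finite (Localization S) (LocalizedModule S A) := by
  obtain ⟨N, hN, h⟩ := h
  suffices N.localized S = ⊤ from ⟨this ▸ Submodule.localized_fg S hN⟩
  refine eq_top_iff.2 fun y _ => ?_
  obtain ⟨⟨x, t⟩, rfl⟩ := IsLocalizedModule.mk'_surjective S (LocalizedModule.mkLinearMap S A) y
  obtain ⟨s, hs, hx⟩ := h x
  exact ⟨_, hx, (⟨s, hs⟩ : S) * t, IsLocalizedModule.mk'_cancel_left _ x ⟨s, hs⟩ t⟩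

theorem SFinite.of_module_finite_localizedModule
    (h : Module.Finite (Localization S) (LocalizedModule S A)) : SFinite S A := by
  classical
  obtain ⟨T, hT⟩ := h
  choose v hv using IsLocalizedModule.mk'_surjective S (LocalizedModule.mkLinearMap S A)
  let N := Submodule.span R ((T.image fun y => (v y).1 : Finset A) : Set A)
  have hN : N.localized S = ⊤ := by
    rw [eq_top_iff, ← hT, Submodule.span_le]
    exact fun y hy => ⟨_, Submodule.subset_span (Finset.mem_image_of_mem _ hy), _, hv y⟩
  refine ⟨N, ⟨_, rfl⟩, fun x => ?_⟩
  obtain ⟨n, hn, s, hx⟩ : LocalizedModule.mkLinearMap S A x ∈ N.localized S := hN ▸ trivial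
  rw [IsLocalizedModule.mk'_eq_iff, ← LinearMap.map_smul_of_tower,
    IsLocalizedModule.eq_iff_exists S] at hx
  obtain ⟨c, hc⟩ := hx
  refine ⟨c * s, (c * s).2, ?_⟩
  rw [mul_smul]
  exact (show c • n = c • s • x from hc) ▸ N.smul_mem _ hn

/-- Finitely many elements, each moved into a submodule by some element of `S`, are moved into it
by a common element of `S`. -/
theorem Submodule.FG.exists_smul_le {N N' : Submodule R A} (hN : N.FG)
    (h : ∀ x ∈ N, ∃ s ∈ S, s • x ∈ N') : ∃ s ∈ S, ∀ x ∈ N, s • x ∈ N' := by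
  classical
  obtain ⟨T, rfl⟩ := hN
  choose! c hc hcN using h
  refine ⟨∏ x ∈ T, c x, prod_mem fun x hx => hc x (Submodule.subset_span hx), fun x hx => ?_⟩
  have : Submodule.span R (T : Set A) ≤ N'.comap (LinearMap.lsmul R A (∏ x ∈ T, c x)) := by
    refine Submodule.span_le.2 fun y hy => ?_
    have hy' : y ∈ T := hy
    change (∏ x ∈ T, c x) • y ∈ N'
    rw [← Finset.prod_erase_mul _ _ hy', mul_smul]
    exact N'.smul_mem _ (hcN y (Submodule.subset_span hy))
  exact this hx

theorem SFinite.exists_torsionFree [IsNoetherianRing R] (h : SFinite S A) :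
    ∃ N : Submodule R A, N.FG ∧ (∀ x, ∃ s ∈ S, s • x ∈ N) ∧
      ∀ x ∈ N, ∀ s ∈ S, s • x = 0 → x = 0 := by
  obtain ⟨N, hN, h⟩ := h
  have : Module.Finite R N := .of_fg hN
  have hT : (⊤ : Submodule R (Submodule.torsion' R N S)).FG := IsNoetherian.noetherian _
  obtain ⟨c, hc, hcN⟩ := hT.exists_smul_le (N' := ⊥) (S := S) fun x _ => by
    obtain ⟨s, hs⟩ := x.2
    exact ⟨s, s.2, Subtype.ext hs⟩
  refine ⟨N.map (LinearMap.lsmul R A c), hN.map _, fun x => ?_, ?_⟩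
  · obtain ⟨s, hs, hx⟩ := h x
    exact ⟨c * s, mul_mem hc hs, s • x, hx, (mul_smul c s x).symm⟩
  · rintro _ ⟨x, hx, rfl⟩ s hs hsx
    have hx' : (⟨x, hx⟩ : N) ∈ Submodule.torsion' R N S :=
      ⟨⟨s * c, mul_mem hs hc⟩, Subtype.ext ((mul_smul s c x).trans hsx)⟩
    exact congrArg (fun y => (y.1 : A)) ((Submodule.mem_bot R).1 (hcN ⟨_, hx'⟩ trivial))

theorem exists_smul_mem_of_pow_smul_eq_zero [IsNoetherianRing R] {a : Ideal R}
    {N : Submodule R A} (hN : ∀ x ∈ (⊥ : Submodule R A).idealColon a, ∃ s ∈ S, s • x ∈ N) (k : ℕ) :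
    ∀ y ∈ (⊥ : Submodule R A).idealColon (a ^ k), (∀ s ∈ S, s • y ≠ 0) →
      ∃ c : R, c • y ∈ N ∧ c • y ≠ 0 := by
  induction k with
  | zero =>
    intro y hy hys
    exact absurd (hy 1 (by simp)) (hys 1 S.one_mem)
  | succ k ih =>
    intro y hy hys
    by_cases hr : ∃ r ∈ a, ∀ s ∈ S, s • r • y ≠ 0
    · obtain ⟨r, hr, hrs⟩ := hr
      obtain ⟨c, hc⟩ := ih (r • y) (fun r' hr' => by
        rw [smul_smul]; exact hy _ (pow_succ a k ▸ Ideal.mul_mem_mul hr' hr)) hrs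
      exact ⟨c * r, by simpa [mul_smul] using hc⟩
    · push Not at hr
      obtain ⟨s, hs, hsa⟩ := (IsNoetherian.noetherian a).exists_smul_le (S := S)
        (N' := LinearMap.ker (LinearMap.toSpanSingleton R A y))
        fun r hra => by simpa [mul_smul] using hr r hra
      obtain ⟨s', hs', hN'⟩ := hN (s • y) fun r hra => by
        have := hsa r hra
        rw [smul_smul, mul_comm]
        simpa using this
      rw [smul_smul] at hN'
      exact ⟨s' * s, hN', hys _ (mul_mem hs' hs)⟩

/-- Let every element of `A` be killed by a power of `a` and let `(0 :_A a)` be `S`-finite. If `A`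
becomes finite at every prime avoiding `S`, then `A` is `S`-finite. -/
theorem SFinite.of_forall_prime [IsNoetherianRing R] {a : Ideal R}
    (htors : ∀ x : A, ∃ k, x ∈ (⊥ : Submodule R A).idealColon (a ^ k))
    (hT : SFinite S ((⊥ : Submodule R A).idealColon a))
    (hp : ∀ (p : Ideal R) [p.IsPrime], (∀ s ∈ S, s ∉ p) → SFinite p.primeCompl A) :
    SFinite S A := by
  obtain ⟨N₀, hN₀, hN₀S, hfree⟩ := hT.exists_torsionFree
  have : Module.Finite R N₀ := .of_fg hN₀
  have hpow : ∀ p ∈ associatedPrimes R N₀, ∃ n, ∀ x : A, ∃ s ∉ p,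
      s • x ∈ (⊥ : Submodule R A).idealColon (a ^ n) := by
    intro p hpN
    have := hpN.isPrime
    obtain ⟨-, w, hw⟩ := isAssociatedPrime_iff.1 hpN
    obtain ⟨N, ⟨T, rfl⟩, hN⟩ := hp p fun s hs hsp => this.ne_top (by
      have hw0 : w = 0 := Subtype.ext (hfree _ w.2 s hs (by
        rw [hw, Submodule.mem_colon_singleton] at hsp
        exact congrArg Subtype.val hsp))
      rw [hw, hw0, Ideal.eq_top_iff_one, Submodule.mem_colon_singleton]
      simp)
    choose k hk using htors
    have hle : Submodule.span R (T : Set A) ≤ (⊥ : Submodule R A).idealColon (a ^ T.sup k) :=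
      Submodule.span_le.2 fun x hx r hr => hk x r (Ideal.pow_le_pow_right (Finset.le_sup hx) hr)
    refine ⟨T.sup k, fun x => ?_⟩
    obtain ⟨s, hs, hx⟩ := hN x
    exact ⟨s, hs, hle hx⟩
  choose! n hn using hpow
  obtain ⟨m, hm⟩ := ((associatedPrimes.finite R N₀).image n).bddAbove
  have key : ∀ x : A, ∀ r ∈ a ^ m, ∃ s ∈ S, s • r • x = 0 := by
    by_contra! hcon
    obtain ⟨x, r, hr, hx⟩ := hcon
    obtain ⟨k, hk⟩ := htors (r • x)
    obtain ⟨c, hcN, hc0⟩ := exists_smul_mem_of_pow_smul_eq_zero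
      (N := N₀.map (Submodule.subtype _)) (fun x hx => by
        obtain ⟨s, hs, h⟩ := hN₀S ⟨x, hx⟩
        exact ⟨s, hs, _, h, rfl⟩) k _ hk hx
    obtain ⟨w, hw, hwc⟩ := hcN
    obtain ⟨p, hpN, hple⟩ := exists_le_isAssociatedPrime_of_isNoetherianRing R (⟨w, hw⟩ : N₀)
      (fun h => hc0 (by rw [← hwc]; exact congrArg (fun y : N₀ => (y.1 : A)) h))
    obtain ⟨s, hs, hsx⟩ := hn p hpN x
    refine hs (hple ?_)
    rw [Submodule.mem_colon_singleton]
    refine Subtype.ext (Subtype.ext ?_)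
    change s • (w : A) = 0
    rw [show (w : A) = c • r • x from hwc, smul_comm s c, smul_comm s r]
    have := hsx r (Ideal.pow_le_pow_right (hm ⟨p, hpN, rfl⟩) hr)
    rw [(Submodule.mem_bot R).1 this, smul_zero]
  obtain ⟨N, hN, hNS⟩ := hT.idealColon_pow m
  refine ⟨N.map (Submodule.subtype _), hN.map _, fun x => ?_⟩
  obtain ⟨s, hs, hsx⟩ := (IsNoetherian.noetherian (a ^ m)).exists_smul_le (S := S)
    (N' := LinearMap.ker (LinearMap.toSpanSingleton R A x))
    fun r hr => by simpa [mul_smul] using key x r hr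
  obtain ⟨s', hs', h⟩ := hNS ⟨s • x, fun r hr => by
    rw [smul_smul, mul_comm]
    simpa using hsx r hr⟩
  exact ⟨s' * s, mul_mem hs' hs, _, h, (mul_smul s' s x).symm⟩

end SFinite

section PowExt
open Abelian

variable {R : Type u} [CommRing R]

/-- The cyclic module defined by a power of an ideal. -/
abbrev powQuot (a : Ideal R) (n : ℕ) : ModuleCat.{u} R := ModuleCat.of R (R ⧸ a ^ n)

/-- The projection between the cyclic modules defined by two powers of an ideal. -/
def powQuotMap (a : Ideal R) {m n : ℕ} (h : m ≤ n) : powQuot a n ⟶ powQuot a m :=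
  ModuleCat.ofHom (Submodule.mapQ _ _ LinearMap.id (Ideal.pow_le_pow_right h))

theorem powQuotMap_self (a : Ideal R) (n : ℕ) : powQuotMap a (le_refl n) = 𝟙 _ := by
  ext
  rfl

theorem powQuotMap_comp (a : Ideal R) {l m n : ℕ} (h : l ≤ m) (h' : m ≤ n) :
    powQuotMap a h' ≫ powQuotMap a h = powQuotMap a (h.trans h') := by
  ext
  rfl

/-- The transition maps between the modules `Ext i (R ⧸ a ^ n) M`. -/
noncomputable def powExtMap (a : Ideal R) (M : ModuleCat.{u} R) (i : ℕ) (m n : ℕ) (h : m ≤ n) :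
    Ext.{u} (powQuot a m) M i →ₗ[R] Ext.{u} (powQuot a n) M i :=
  (Ext.mk₀ (powQuotMap a h)).precompOfLinear R M (zero_add i)

theorem powExtMap_apply (a : Ideal R) (M : ModuleCat.{u} R) (i : ℕ) (m n : ℕ) (h : m ≤ n)
    (α : Ext.{u} (powQuot a m) M i) :
    powExtMap a M i m n h α = (Ext.mk₀ (powQuotMap a h)).comp α (zero_add i) := rfl

theorem powExtMap_comp {a : Ideal R} {M N : ModuleCat.{u} R} {i j k : ℕ} {m n : ℕ} (h : m ≤ n)
    (α : Ext.{u} (powQuot a m) M i) (β : Ext.{u} M N j) (hk : i + j = k) :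
    powExtMap a N k m n h (α.comp β hk) = (powExtMap a M i m n h α).comp β hk := by
  rw [powExtMap_apply, powExtMap_apply]
  exact (Ext.comp_assoc _ _ _ (zero_add i) hk (by lia)).symm

instance (a : Ideal R) (M : ModuleCat.{u} R) (i : ℕ) :
    DirectedSystem (fun n => Ext.{u} (powQuot a n) M i) (powExtMap a M i · · ·) where
  map_self n α := by
    rw [powExtMap_apply, powQuotMap_self, Ext.mk₀_id_comp]
  map_map l m n hm hn α := by
    simp only [powExtMap_apply]
    rw [← Ext.comp_assoc _ _ _ (zero_add 0) (zero_add i) (by lia), Ext.mk₀_comp_mk₀,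
      powQuotMap_comp]

/-- The direct limit of the modules `Ext i (R ⧸ a ^ n) M`. -/
abbrev PowExt (a : Ideal R) (M : ModuleCat.{u} R) (i : ℕ) : Type u :=
  Module.DirectLimit (fun n => Ext.{u} (powQuot a n) M i) (powExtMap a M i)

namespace PowExt

variable {a : Ideal R} {M N : ModuleCat.{u} R} {i j k : ℕ}

variable (a) in
/-- The map to the direct limit. -/
noncomputable abbrev of (M : ModuleCat.{u} R) (i n : ℕ) :
    Ext.{u} (powQuot a n) M i →ₗ[R] PowExt a M i :=
  Module.DirectLimit.of R ℕ (fun n => Ext.{u} (powQuot a n) M i) (powExtMap a M i) n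

theorem of_map {m n : ℕ} (h : m ≤ n) (α : Ext.{u} (powQuot a m) M i) :
    of a M i n (powExtMap a M i m n h α) = of a M i m α :=
  Module.DirectLimit.of_f

theorem exists_of (x : PowExt a M i) : ∃ n α, of a M i n α = x :=
  Module.DirectLimit.exists_of x

theorem exists_map_eq_zero {n : ℕ} {α : Ext.{u} (powQuot a n) M i} (h : of a M i n α = 0) :
    ∃ m, ∃ hm : n ≤ m, powExtMap a M i n m hm α = 0 :=
  Module.DirectLimit.of.zero_exact h

variable (a) in
/-- The map on direct limits induced by composition with an extension class. -/
noncomputable def postcomp (β : Ext.{u} M N j) (hk : i + j = k) : PowExt a M i →ₗ[R] PowExt a N k :=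
  Module.DirectLimit.map (fun n => β.postcompOfLinear R (powQuot a n) hk) fun m n h => by
    ext α
    exact (powExtMap_comp h α β hk).symm

theorem postcomp_of (β : Ext.{u} M N j) (hk : i + j = k) {n : ℕ} (α : Ext.{u} (powQuot a n) M i) :
    postcomp a β hk (of a M i n α) = of a N k n (α.comp β hk) :=
  Module.DirectLimit.map_apply_of _ _ _

theorem exact_of_exact {L : ModuleCat.{u} R} {j' k' : ℕ} (β : Ext.{u} L M j) (hk : i + j = k)
    (γ : Ext.{u} M N j') (hk' : k + j' = k')
    (hex : ∀ (X : ModuleCat.{u} R) (α : Ext.{u} X M k), α.comp γ hk' = 0 →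
      ∃ α' : Ext.{u} X L i, α'.comp β hk = α)
    (x : PowExt a M k) (hx : postcomp a γ hk' x = 0) :
    ∃ y : PowExt a L i, postcomp a β hk y = x := by
  obtain ⟨n, α, rfl⟩ := exists_of x
  rw [postcomp_of] at hx
  obtain ⟨m, hm, hα⟩ := exists_map_eq_zero hx
  rw [powExtMap_comp] at hα
  obtain ⟨α', h⟩ := hex _ _ hα
  exact ⟨of a L i m α', by rw [postcomp_of, h, of_map]⟩

theorem exact₁ {E : ShortComplex (ModuleCat.{u} R)} (hE : E.ShortExact)
    (x : PowExt a E.X₁ (i + 1))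
    (hx : postcomp a (Ext.mk₀ E.f) (add_zero (i + 1)) x = 0) :
    ∃ y : PowExt a E.X₃ i, postcomp a hE.extClass rfl y = x :=
  exact_of_exact _ _ _ _ (fun X α hα => Ext.covariant_sequence_exact₁ X hE α hα rfl) x hx

theorem exact₂ {E : ShortComplex (ModuleCat.{u} R)} (hE : E.ShortExact)
    (x : PowExt a E.X₂ i) (hx : postcomp a (Ext.mk₀ E.g) (add_zero i) x = 0) :
    ∃ y : PowExt a E.X₁ i, postcomp a (Ext.mk₀ E.f) (add_zero i) y = x :=
  exact_of_exact _ _ _ _ (fun X α hα => Ext.covariant_sequence_exact₂ X hE α hα) x hx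

theorem exact₃ {E : ShortComplex (ModuleCat.{u} R)} (hE : E.ShortExact)
    (x : PowExt a E.X₃ i)
    (hx : postcomp a hE.extClass (show i + 1 = i + 1 from rfl) x = 0) :
    ∃ y : PowExt a E.X₂ i, postcomp a (Ext.mk₀ E.g) (add_zero i) y = x :=
  exact_of_exact _ _ _ _ (fun X α hα => Ext.covariant_sequence_exact₃ X hE α rfl hα) x hx

theorem postcomp_smul_id (r : R) (x : PowExt a M i) :
    postcomp a (Ext.mk₀ (r • 𝟙 M)) (add_zero i) x = r • x := by
  obtain ⟨n, α, rfl⟩ := exists_of x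
  rw [postcomp_of, ← Ext.smul_eq_comp_mk₀, map_smul]

theorem exists_forall_smul_eq_zero (x : PowExt a M i) : ∃ n, ∀ r ∈ a ^ n, r • x = 0 := by
  obtain ⟨n, α, rfl⟩ := exists_of x
  refine ⟨n, fun r hr => ?_⟩
  have : r • 𝟙 (powQuot a n) = 0 := by
    ext
    exact (Submodule.Quotient.mk_eq_zero (a ^ n)).2 (by simpa using hr)
  rw [← map_smul, ← Ext.mk₀_id_comp α, ← Ext.smul_comp, ← Ext.mk₀_smul, this, Ext.mk₀_zero,
    Ext.zero_comp, map_zero]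

/-- In degree zero, the direct limit embeds into the module. -/
theorem exists_injective_zero (a : Ideal R) (M : ModuleCat.{u} R) :
    ∃ f : PowExt a M 0 →ₗ[R] M, Function.Injective f := by
  let g (n : ℕ) : Ext.{u} (powQuot a n) M 0 →ₗ[R] M :=
    { toFun := fun α => (Ext.linearEquiv₀ (R := R) α).hom (1 : R ⧸ a ^ n)
      map_add' := fun α β => by rw [map_add]; rfl
      map_smul' := fun r α => by rw [map_smul]; rfl }
  have hg (n) : Function.Injective (g n) := by
    intro α β h
    apply (Ext.linearEquiv₀ (R := R)).injective
    ext
    exact h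
  refine ⟨Module.DirectLimit.lift R ℕ _ _ g fun m n h α => ?_,
    Module.DirectLimit.lift_injective _ _ hg⟩
  obtain ⟨f, rfl⟩ := (Ext.linearEquiv₀ (R := R)).symm.surjective α
  change (Ext.linearEquiv₀ (R := R) ((Ext.mk₀ (powQuotMap a h)).comp (Ext.mk₀ f) (zero_add 0))).hom
    (1 : R ⧸ a ^ n) = (Ext.linearEquiv₀ (R := R) ((Ext.linearEquiv₀ (R := R)).symm f)).hom
      (1 : R ⧸ a ^ m)
  rw [Ext.mk₀_comp_mk₀, LinearEquiv.apply_symm_apply]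
  exact congrArg (fun k => k.hom (1 : R ⧸ a ^ n))
    ((Ext.linearEquiv₀ (R := R)).apply_symm_apply (powQuotMap a h ≫ f))

end PowExt

end PowExt

section OpHomology
open Opposite

variable {R : Type u} [CommRing R]

/-- The cocycles of a chain complex in the opposite category of modules. -/
def opCocycles (K : ChainComplex (ModuleCat.{u} R)ᵒᵖ ℕ) (n : ℕ) : Submodule R (K.X n).unop :=
  LinearMap.ker (K.d (n + 1) n).unop.hom

theorem d_comp_opCocycles_subtype (K : ChainComplex (ModuleCat.{u} R)ᵒᵖ ℕ) (n : ℕ) :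
    K.d (n + 1) n ≫ (ModuleCat.ofHom (opCocycles K n).subtype).op = 0 := by
  apply Quiver.Hom.unop_inj
  ext x
  exact x.2

/-- The class in homology of a cocycle. -/
noncomputable def opHomologyClass (K : ChainComplex (ModuleCat.{u} R)ᵒᵖ ℕ) (n : ℕ) :
    opCocycles K n →ₗ[R] (K.homology n).unop :=
  (K.homologyι n ≫ K.descOpcycles (ModuleCat.ofHom (opCocycles K n).subtype).op (n + 1)
    (by simp) (d_comp_opCocycles_subtype K n)).unop.hom

theorem pOpcycles_descOpcycles_apply (K : ChainComplex (ModuleCat.{u} R)ᵒᵖ ℕ) (n : ℕ)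
    (x : opCocycles K n) :
    (K.pOpcycles n).unop.hom ((K.descOpcycles (ModuleCat.ofHom (opCocycles K n).subtype).op
      (n + 1) (by simp) (d_comp_opCocycles_subtype K n)).unop.hom x) = x := by
  have := congrArg (fun f => f.unop.hom x) (K.p_descOpcycles
    (ModuleCat.ofHom (opCocycles K n).subtype).op (n + 1) (by simp)
    (d_comp_opCocycles_subtype K n))
  exact this

theorem pOpcycles_unop_injective (K : ChainComplex (ModuleCat.{u} R)ᵒᵖ ℕ) (n : ℕ) :
    Function.Injective (K.pOpcycles n).unop.hom :=
  (ModuleCat.mono_iff_injective _).1 inferInstance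

theorem opHomologyClass_surjective (K : ChainComplex (ModuleCat.{u} R)ᵒᵖ ℕ) (n : ℕ) :
    Function.Surjective (opHomologyClass K n) := by
  intro h
  obtain ⟨c, rfl⟩ := (ModuleCat.epi_iff_surjective (K.homologyι n).unop).1 inferInstance h
  have hc : (K.pOpcycles n).unop.hom c ∈ opCocycles K n := by
    have := congrArg (fun f => f.unop.hom c) (K.d_pOpcycles (n + 1) n)
    exact this
  refine ⟨⟨_, hc⟩, congrArg (K.homologyι n).unop.hom ?_⟩
  exact pOpcycles_unop_injective K n (pOpcycles_descOpcycles_apply K n ⟨_, hc⟩)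

theorem opHomologyClass_eq_zero_iff (K : ChainComplex (ModuleCat.{u} R)ᵒᵖ ℕ) (n m : ℕ)
    (hm : (ComplexShape.down ℕ).next n = m) (x : opCocycles K n) :
    opHomologyClass K n x = 0 ↔ ∃ y, (K.d n m).unop.hom y = x := by
  let S : ShortComplex (ModuleCat.{u} R)ᵒᵖ :=
    ShortComplex.mk (K.homologyι n) (K.fromOpcycles n m) (K.homologyι_comp_fromOpcycles n m)
  have hS : S.Exact := S.exact_of_f_is_kernel (K.homologyIsKernel n m hm)
  have h1 := (ShortComplex.moduleCat_exact_iff _).1 hS.unop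
  have key (y) : (K.pOpcycles n).unop.hom ((K.fromOpcycles n m).unop.hom y) =
      (K.d n m).unop.hom y :=
    congrArg (fun f => f.unop.hom y) (K.p_fromOpcycles n m)
  constructor
  · intro h
    obtain ⟨y, hy⟩ := h1 _ h
    refine ⟨y, (key y).symm.trans ?_⟩
    rw [← pOpcycles_descOpcycles_apply K n x]
    exact congrArg _ hy
  · rintro ⟨y, hy⟩
    have : (K.fromOpcycles n m).unop.hom y = _ :=
      pOpcycles_unop_injective K n (((key y).trans hy).trans
        (pOpcycles_descOpcycles_apply K n x).symm)
    refine (congrArg (K.homologyι n).unop.hom this.symm).trans ?_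
    exact congrArg (fun f => f.unop.hom y) (K.homologyι_comp_fromOpcycles n m)

theorem homologyMap_opHomologyClass {K L : ChainComplex (ModuleCat.{u} R)ᵒᵖ ℕ} (φ : K ⟶ L)
    (n : ℕ) (x : opCocycles L n) (x' : opCocycles K n)
    (hx : (x' : (K.X n).unop) = (φ.f n).unop.hom x) :
    (HomologicalComplex.homologyMap φ n).unop.hom (opHomologyClass L n x) =
      opHomologyClass K n x' := by
  refine (congrArg (fun f => f.unop.hom ((L.descOpcycles _ (n + 1)
    (by simp) (d_comp_opCocycles_subtype L n)).unop.hom x))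
      (HomologicalComplex.homologyι_naturality φ n)).trans
        (congrArg (K.homologyι n).unop.hom (pOpcycles_unop_injective K n ?_))
  refine Eq.trans ?_ (pOpcycles_descOpcycles_apply K n x').symm
  refine Eq.trans ?_ hx.symm
  refine (congrArg (fun f => f.unop.hom ((L.descOpcycles _ (n + 1)
    (by simp) (d_comp_opCocycles_subtype L n)).unop.hom x))
      (HomologicalComplex.p_opcyclesMap φ n)).trans ?_
  exact congrArg (φ.f n).unop.hom (pOpcycles_descOpcycles_apply L n x)

end OpHomology

section CompareExt
open Opposite

variable {R : Type u} [CommRing R]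

theorem CategoryTheory.ProjectiveResolution.extMk_eq_zero_iff_next {X Y : ModuleCat.{u} R}
    (P : ProjectiveResolution X) {n : ℕ} (m : ℕ) (hm : (ComplexShape.down ℕ).next n = m)
    (f : P.complex.X n ⟶ Y) (hf : P.complex.d (n + 1) n ≫ f = 0) :
    P.extMk f (n + 1) rfl hf = 0 ↔ ∃ g : P.complex.X m ⟶ Y, P.complex.d n m ≫ g = f := by
  cases n with
  | succ p =>
    obtain rfl : p = m := by simpa using hm
    exact P.extMk_eq_zero_iff f _ rfl hf p rfl
  | zero =>
    obtain rfl : 0 = m := by simpa using hm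
    have h0 : P.complex.d 0 0 = 0 := P.complex.shape _ _ (by simp)
    constructor
    · intro h
      refine ⟨0, ?_⟩
      simp only [← P.extEquivCohomologyClass.apply_eq_iff_eq,
        ProjectiveResolution.extEquivCohomologyClass_extMk,
        ProjectiveResolution.extEquivCohomologyClass_zero,
        CochainComplex.HomComplex.CohomologyClass.mk_eq_zero_iff] at h
      rw [CochainComplex.HomComplex.Cocycle.toSingleMk_mem_coboundaries_iff _ _ _ _ _ 1
        (by simp)] at h
      obtain ⟨g, hg⟩ := h
      have : g = 0 := (P.cochainComplex.isZero_of_isStrictlyLE 0 1 (by simp)).eq_of_src _ _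
      subst this
      rw [Limits.comp_zero] at hg ⊢
      exact ((cancel_epi (P.cochainComplexXIso (-(0:ℕ)) 0 rfl).hom).1
        (by rw [← hg, Limits.comp_zero]))
    · rintro ⟨g, rfl⟩
      simp

/-- The functor whose left derived functors define `Ext`. -/
noncomputable abbrev homOp (Y : ModuleCat.{u} R) : ModuleCat.{u} R ⥤ (ModuleCat.{u} R)ᵒᵖ :=
  ((linearYoneda R (ModuleCat.{u} R)).obj Y).rightOp

/-- The complex of morphisms from a resolution into `Y`. -/
noncomputable abbrev homOpComplex (Y : ModuleCat.{u} R) {X : ModuleCat.{u} R}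
    (P : ProjectiveResolution X) : ChainComplex (ModuleCat.{u} R)ᵒᵖ ℕ :=
  ((homOp Y).mapHomologicalComplex _).obj P.complex

theorem d_comp_opCocycles {X Y : ModuleCat.{u} R} (P : ProjectiveResolution X) (n : ℕ)
    (f : opCocycles (homOpComplex Y P) n) :
    P.complex.d (n + 1) n ≫ (show P.complex.X n ⟶ Y from f.1) = 0 := f.2

theorem extMk_smul {X Y : ModuleCat.{u} R} (P : ProjectiveResolution X) {n : ℕ} (r : R)
    (f : P.complex.X n ⟶ Y) (hf : P.complex.d (n + 1) n ≫ f = 0)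
    (hf' : P.complex.d (n + 1) n ≫ (r • f) = 0) :
    P.extMk (r • f) (n + 1) rfl hf' = r • P.extMk f (n + 1) rfl hf := by
  rw [Abelian.Ext.smul_eq_comp_mk₀, P.extMk_comp_mk₀]
  congr 1

/-- The class in `Ext` of a cocycle. -/
noncomputable def extClass {X : ModuleCat.{u} R} (P : ProjectiveResolution X)
    (Y : ModuleCat.{u} R) (n : ℕ) :
    opCocycles (homOpComplex Y P) n →ₗ[R] Abelian.Ext.{u} X Y n where
  toFun f := P.extMk (show P.complex.X n ⟶ Y from f.1) (n + 1) rfl (d_comp_opCocycles P n f)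
  map_add' _ _ := (P.add_extMk _ _ _ _ _ _).symm
  map_smul' r _ := extMk_smul P r _ _ _

theorem extClass_surjective {X : ModuleCat.{u} R} (P : ProjectiveResolution X)
    (Y : ModuleCat.{u} R) (n : ℕ) : Function.Surjective (extClass P Y n) := by
  intro α
  obtain ⟨f, hf, h⟩ := P.extMk_surjective α (n + 1) rfl
  exact ⟨⟨f, hf⟩, h⟩

theorem ker_extClass {X : ModuleCat.{u} R} (P : ProjectiveResolution X)
    (Y : ModuleCat.{u} R) (n : ℕ) :
    LinearMap.ker (extClass P Y n) =
      LinearMap.ker (opHomologyClass (homOpComplex Y P) n) := by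
  ext f
  exact (P.extMk_eq_zero_iff_next _ rfl _ (d_comp_opCocycles P n f)).trans
    (opHomologyClass_eq_zero_iff _ n _ rfl f).symm

/-- The class of a cocycle in the derived functor version of `Ext`. -/
noncomputable def derivedExtClass {X : ModuleCat.{u} R} (P : ProjectiveResolution X)
    (Y : ModuleCat.{u} R) (n : ℕ) :
    opCocycles (homOpComplex Y P) n →ₗ[R] ((Ext R (ModuleCat.{u} R) n).obj (op X)).obj Y :=
  (P.isoLeftDerivedObj (homOp Y) n).unop.toLinearEquiv.toLinearMap ∘ₗ
    opHomologyClass (homOpComplex Y P) n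

theorem derivedExtClass_surjective {X : ModuleCat.{u} R} (P : ProjectiveResolution X)
    (Y : ModuleCat.{u} R) (n : ℕ) : Function.Surjective (derivedExtClass P Y n) :=
  (P.isoLeftDerivedObj (homOp Y) n).unop.toLinearEquiv.surjective.comp
    (opHomologyClass_surjective _ n)

theorem ker_derivedExtClass {X : ModuleCat.{u} R} (P : ProjectiveResolution X)
    (Y : ModuleCat.{u} R) (n : ℕ) :
    LinearMap.ker (derivedExtClass P Y n) = LinearMap.ker (extClass P Y n) := by
  rw [ker_extClass]
  ext f
  exact (P.isoLeftDerivedObj (homOp Y) n).unop.toLinearEquiv.map_eq_zero_iff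

/-- The two versions of `Ext` agree. -/
noncomputable def extEquiv (X Y : ModuleCat.{u} R) (n : ℕ) :
    ((Ext R (ModuleCat.{u} R) n).obj (op X)).obj Y ≃ₗ[R] Abelian.Ext.{u} X Y n :=
  ((derivedExtClass (projectiveResolution X) Y n).quotKerEquivOfSurjective
    (derivedExtClass_surjective _ Y n)).symm.trans
    ((Submodule.quotEquivOfEq _ _ (ker_derivedExtClass _ Y n)).trans
    ((extClass (projectiveResolution X) Y n).quotKerEquivOfSurjective (extClass_surjective _ Y n)))

theorem extEquiv_derivedExtClass (X Y : ModuleCat.{u} R) (n : ℕ)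
    (f : opCocycles (homOpComplex Y (projectiveResolution X)) n) :
    extEquiv X Y n (derivedExtClass (projectiveResolution X) Y n f) =
      extClass (projectiveResolution X) Y n f := by
  have : ((derivedExtClass (projectiveResolution X) Y n).quotKerEquivOfSurjective
    (derivedExtClass_surjective _ Y n)).symm (derivedExtClass (projectiveResolution X) Y n f) =
      Submodule.Quotient.mk f := by
    rw [LinearEquiv.symm_apply_eq]
    rfl
  simp only [extEquiv, LinearEquiv.trans_apply]
  rw [this]
  rfl

theorem extEquiv_naturality {X X' : ModuleCat.{u} R} (g : X' ⟶ X) (Y : ModuleCat.{u} R) (n : ℕ)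
    (h : ((Ext R (ModuleCat.{u} R) n).obj (op X)).obj Y) :
    extEquiv X' Y n ((((Ext R (ModuleCat.{u} R) n).map g.op).app Y).hom h) =
      (Abelian.Ext.mk₀ g).comp (extEquiv X Y n h) (zero_add n) := by
  obtain ⟨f, rfl⟩ := derivedExtClass_surjective (projectiveResolution X) Y n h
  let P := projectiveResolution X
  let P' := projectiveResolution X'
  let φ : ProjectiveResolution.Hom P' P g :=
    { hom := ProjectiveResolution.lift g P' P
      hom_f_zero_comp_π_f_zero := by
        simpa using ProjectiveResolution.lift_commutes_zero g P' P }
  let f' : opCocycles (homOpComplex Y P') n := ⟨φ.hom.f n ≫ f.1, by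
    change P'.complex.d (n + 1) n ≫ φ.hom.f n ≫ (show P.complex.X n ⟶ Y from f.1) = 0
    rw [← φ.hom.comm_assoc, d_comp_opCocycles, Limits.comp_zero]⟩
  have h1 : (((Ext R (ModuleCat.{u} R) n).map g.op).app Y).hom (derivedExtClass P Y n f) =
      derivedExtClass P' Y n f' := by
    have := ProjectiveResolution.isoLeftDerivedObj_hom_naturality g P' P φ.hom
      φ.hom_f_zero_comp_π_f_zero (homOp Y) n
    refine (congrArg (fun k => k.unop.hom (opHomologyClass (homOpComplex Y P) n f)) this).trans ?_
    refine congrArg (P'.isoLeftDerivedObj (homOp Y) n).unop.hom.hom ?_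
    exact homologyMap_opHomologyClass _ n f f' rfl
  rw [h1, extEquiv_derivedExtClass, extEquiv_derivedExtClass]
  exact (ProjectiveResolution.mk₀_comp_extMk _ _ rfl (d_comp_opCocycles P n f) φ).symm

end CompareExt

section Compare
open Opposite Limits

variable {R : Type u} [CommRing R]

/-- A colimit over the natural numbers is isomorphic to the direct limit of an isomorphic
directed system. -/
theorem exists_directLimit_equiv_of_isColimit {G : ℕᵒᵖᵒᵖ ⥤ ModuleCat.{u} R} {c : Cocone G}
    (hc : IsColimit c) {A : ℕ → Type u} [∀ n, AddCommGroup (A n)] [∀ n, Module R (A n)]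
    (f : ∀ m n, m ≤ n → A m →ₗ[R] A n) (e : ∀ n, G.obj (op (op n)) ≃ₗ[R] A n)
    (he : ∀ {m n : ℕ} (h : m ≤ n) (x : G.obj (op (op m))),
      e n ((G.map (homOfLE h).op.op).hom x) = f m n h (e m x)) :
    Nonempty (Module.DirectLimit A f ≃ₗ[R] c.pt) := by
  have : PreservesFilteredColimitsOfSize.{0, 0} (forget (ModuleCat.{u} R)) :=
    preservesFilteredColimitsOfSize_shrink.{0, u, 0, u} _
  let g (n : ℕ) : A n →ₗ[R] c.pt := (c.ι.app (op (op n))).hom ∘ₗ (e n).symm.toLinearMap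
  have hge (n : ℕ) (x) : g n (e n x) = (c.ι.app (op (op n))).hom x :=
    congrArg (c.ι.app (op (op n))).hom ((e n).symm_apply_apply x)
  have hg (m n : ℕ) (h : m ≤ n) (α) : g n (f m n h α) = g m α := by
    obtain ⟨x, rfl⟩ := (e m).surjective α
    rw [← he, hge, hge]
    exact congrArg (fun k => k.hom x) (c.w (homOfLE h).op.op)
  refine ⟨LinearEquiv.ofBijective (Module.DirectLimit.lift R ℕ _ _ g hg) ⟨?_, ?_⟩⟩
  · rw [injective_iff_map_eq_zero]
    intro x hx
    obtain ⟨n, α, rfl⟩ := Module.DirectLimit.exists_of x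
    obtain ⟨x, rfl⟩ := (e n).surjective α
    rw [Module.DirectLimit.lift_of, hge] at hx
    obtain ⟨k, f₁, f₂, hk⟩ := Concrete.isColimit_exists_of_rep_eq G hc x
      (0 : G.obj (op (op n))) (hx.trans (map_zero (c.ι.app (op (op n))).hom).symm)
    have h := leOfHom f₁.unop.unop
    have hk' : (G.map (homOfLE h).op.op).hom x = 0 :=
      hk.trans (map_zero (G.map f₂).hom)
    rw [← Module.DirectLimit.of_f (hij := h), ← he, hk', map_zero, map_zero]
  · intro y
    obtain ⟨n, x, rfl⟩ := Concrete.isColimit_exists_rep G hc y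
    exact ⟨Module.DirectLimit.of R ℕ A f n.unop.unop (e n.unop.unop x),
      (Module.DirectLimit.lift_of _ _ _).trans (hge n.unop.unop x)⟩

/-- The local cohomology module is the direct limit of the modules `Ext i (R ⧸ a ^ n) M`. -/
theorem exists_powExt_equiv_localCohomology (a : Ideal R) (i : ℕ) (M : ModuleCat.{u} R) :
    Nonempty (PowExt a M i ≃ₗ[R] (localCohomology a i).obj M) := by
  have := localCohomology.hasColimitDiagram.{u, 0} (localCohomology.idealPowersDiagram a) i
  exact exists_directLimit_equiv_of_isColimit
    (isColimitOfPreserves ((evaluation (ModuleCat.{u} R) (ModuleCat.{u} R)).obj M)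
      (colimit.isColimit (localCohomology.diagram (localCohomology.idealPowersDiagram a) i)))
    (powExtMap a M i) (fun n => extEquiv (powQuot a n) M i)
    (fun h x => extEquiv_naturality (powQuotMap a h) M i x)

end Compare

section Vanishing
open Abelian

variable {R : Type u} [CommRing R]

theorem comp_ext_eq_zero_of_ker {F L F' L' : Type u} [AddCommGroup F] [Module R F]
    [AddCommGroup L] [Module R L] [AddCommGroup F'] [Module R F'] [AddCommGroup L'] [Module R L']
    [Module.Projective R F] {f : F →ₗ[R] L} (hf : Function.Surjective f) {f' : F' →ₗ[R] L'}
    (hf' : Function.Surjective f') (φ : F' →ₗ[R] F) (ψ : L' →ₗ[R] L) (hφ : ∀ x, f (φ x) = ψ (f' x))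
    (T : Submodule R (LinearMap.ker f))
    (hT : ∀ y : LinearMap.ker f, (∃ x, f' x = 0 ∧ φ x = y) → y ∈ T)
    (M : ModuleCat.{u} R) {j : ℕ}
    (hβ : ∀ β : Ext.{u} (ModuleCat.of R (LinearMap.ker f)) M j,
      (Ext.mk₀ (ModuleCat.ofHom T.subtype)).comp β (zero_add j) = 0)
    (α : Ext.{u} (ModuleCat.of R L) M (j + 1)) :
    (Ext.mk₀ (ModuleCat.ofHom ψ)).comp α (zero_add _) = 0 := by
  obtain ⟨β, rfl⟩ := Ext.contravariant_sequence_exact₃ (LinearMap.shortExact_shortComplexKer hf) M α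
    (Ext.eq_zero_of_projective _) (add_comm 1 j)
  have hker (x : LinearMap.ker f') : φ x ∈ LinearMap.ker f := by
    rw [LinearMap.mem_ker, hφ, x.2, map_zero]
  let ρ : LinearMap.ker f' →ₗ[R] T :=
    ((φ ∘ₗ Submodule.subtype _).codRestrict _ hker).codRestrict T
      fun x => hT _ ⟨x, x.2, rfl⟩
  let Φ : f'.shortComplexKer ⟶ f.shortComplexKer :=
    { τ₁ := ModuleCat.ofHom ρ ≫ ModuleCat.ofHom T.subtype
      τ₂ := ModuleCat.ofHom φ
      τ₃ := ModuleCat.ofHom ψ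
      comm₁₂ := rfl
      comm₂₃ := by
        ext x
        exact hφ x }
  have h := ShortComplex.ShortExact.extClass_naturality (LinearMap.shortExact_shortComplexKer hf')
    (LinearMap.shortExact_shortComplexKer hf) Φ
  have h' : (Ext.mk₀ (ModuleCat.ofHom ψ)).comp
      (LinearMap.shortExact_shortComplexKer hf).extClass (zero_add 1) =
      (LinearMap.shortExact_shortComplexKer hf').extClass.comp (Ext.mk₀ Φ.τ₁) (add_zero 1) := h.symm
  have h0 : (Ext.mk₀ Φ.τ₁).comp β (zero_add j) = 0 := by
    rw [← Ext.mk₀_comp_mk₀, Ext.comp_assoc _ _ _ (zero_add 0) (zero_add j) (by lia), hβ,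
      Ext.comp_zero]
  rw [← Ext.comp_assoc _ _ _ (zero_add 1) (add_comm 1 j) (by lia), h',
    Ext.comp_assoc _ _ _ (add_zero 1) (zero_add j) (by lia), h0, Ext.comp_zero]

/-- Extension classes into a module killed by a power of `a` vanish on a power of `a`. -/
theorem exists_comp_ext_eq_zero [IsNoetherianRing R] {a : Ideal R} {M : ModuleCat.{u} R} {k : ℕ}
    (hk : ∀ r ∈ a ^ k, ∀ m : M, r • m = 0) (j : ℕ) (L : Type u) [AddCommGroup L] [Module R L]
    [Module.Finite R L] : ∃ s, ∀ α : Ext.{u} (ModuleCat.of R L) M j,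
      (Ext.mk₀ (ModuleCat.ofHom (a ^ s • ⊤ : Submodule R L).subtype)).comp α (zero_add j) = 0 := by
  induction j generalizing L with
  | zero =>
    refine ⟨k, fun α => ?_⟩
    obtain ⟨f, rfl⟩ := (Ext.linearEquiv₀ (R := R)).symm.surjective α
    change (Ext.mk₀ _).comp (Ext.mk₀ f) _ = 0
    rw [Ext.mk₀_comp_mk₀]
    have : ModuleCat.ofHom (a ^ k • ⊤ : Submodule R L).subtype ≫ f = 0 := by
      ext ⟨x, hx⟩
      change f.hom x = 0
      refine Submodule.smul_induction_on hx (fun r hr n _ => ?_) fun x y hx hy => ?_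
      · rw [map_smul, hk r hr]
      · rw [map_add, hx, hy, add_zero]
    rw [this, Ext.mk₀_zero]
  | succ j ih =>
    obtain ⟨n, π, hπ⟩ := Module.Finite.exists_fin' R L
    obtain ⟨s, hs⟩ := ih (LinearMap.ker π)
    obtain ⟨c, hc⟩ := Ideal.exists_pow_inf_eq_pow_smul a (LinearMap.ker π)
    refine ⟨s + c, fun α => ?_⟩
    have hmap : Submodule.map π (a ^ (s + c) • ⊤) = a ^ (s + c) • ⊤ := by
      rw [Submodule.map_smul'', Submodule.map_top, LinearMap.range_eq_top.2 hπ]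
    let f' : (a ^ (s + c) • ⊤ : Submodule R (Fin n → R)) →ₗ[R] (a ^ (s + c) • ⊤ : Submodule R L) :=
      (π ∘ₗ Submodule.subtype _).codRestrict _ fun x => hmap ▸ Submodule.mem_map_of_mem x.2
    have hf' : Function.Surjective f' := by
      rintro ⟨y, hy⟩
      obtain ⟨x, hx, rfl⟩ : y ∈ Submodule.map π (a ^ (s + c) • ⊤) := hmap ▸ hy
      exact ⟨⟨x, hx⟩, rfl⟩
    refine comp_ext_eq_zero_of_ker hπ hf' (Submodule.subtype _) (Submodule.subtype _)
      (fun x => rfl) (a ^ s • ⊤) ?_ M hs α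
    rintro y ⟨x, -, hx⟩
    have hy : (y : Fin n → R) ∈ a ^ (s + c) • ⊤ ⊓ LinearMap.ker π := ⟨hx ▸ x.2, y.2⟩
    rw [hc _ (Nat.le_add_left c s), Nat.add_sub_cancel] at hy
    have hle : a ^ s • (a ^ c • ⊤ ⊓ LinearMap.ker π) ≤
        Submodule.map (LinearMap.ker π).subtype (a ^ s • ⊤) := by
      rw [Submodule.map_smul'', Submodule.map_subtype_top]
      exact smul_mono_right _ inf_le_right
    obtain ⟨z, hz, hzy⟩ := hle hy
    rwa [Subtype.ext hzy] at hz

/-- The higher local cohomology of a module killed by a power of `a` vanishes. -/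
theorem PowExt.eq_zero_of_pow_smul_eq_zero [IsNoetherianRing R] {a : Ideal R} {M : ModuleCat.{u} R}
    {k : ℕ} (hk : ∀ r ∈ a ^ k, ∀ m : M, r • m = 0) {i : ℕ} (x : PowExt a M (i + 1)) : x = 0 := by
  obtain ⟨n, α, rfl⟩ := PowExt.exists_of x
  obtain ⟨s, hs⟩ := exists_comp_ext_eq_zero hk i (LinearMap.ker (a ^ n).mkQ)
  have hle : n ≤ s + n := Nat.le_add_left n s
  rw [← PowExt.of_map hle, powExtMap_apply]
  refine (congrArg _ ?_).trans (map_zero _)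
  refine comp_ext_eq_zero_of_ker (Submodule.mkQ_surjective (a ^ n))
    (Submodule.mkQ_surjective (a ^ (s + n))) LinearMap.id _ (fun x => rfl) (a ^ s • ⊤) ?_ M hs α
  rintro y ⟨x, hx, hxy⟩
  have hx' : x ∈ a ^ s • (a ^ n) := by
    rw [Submodule.mkQ_apply, Submodule.Quotient.mk_eq_zero] at hx
    rwa [smul_eq_mul, ← pow_add]
  have hle : a ^ s • (a ^ n) ≤ Submodule.map (LinearMap.ker (a ^ n).mkQ).subtype (a ^ s • ⊤) := by
    rw [Submodule.map_smul'', Submodule.map_subtype_top, Submodule.ker_mkQ]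
  obtain ⟨z, hz, hzy⟩ := hle hx'
  rwa [Subtype.ext (hzy.trans hxy)] at hz

end Vanishing

section Finiteness
open Abelian

theorem exists_isSMulRegular_of_idealColon_bot {R M : Type*} [CommRing R] [IsNoetherianRing R]
    [AddCommGroup M] [Module R M] [Module.Finite R M] {a : Ideal R}
    (h : (⊥ : Submodule R M).idealColon a = ⊥) : ∃ r ∈ a, IsSMulRegular M r := by
  by_contra! hr
  have hsub : (a : Set R) ⊆ ⋃ p ∈ associatedPrimes R M, (p : Set R) := by
    rw [biUnion_associatedPrimes_eq_compl_regular R M]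
    exact fun r hra => hr r hra
  obtain ⟨p, hp, hap⟩ := (Ideal.subset_union_prime_finite (associatedPrimes.finite R M) 0 0
    fun p hp _ _ => hp.1).1 hsub
  obtain ⟨hp', x, rfl⟩ := isAssociatedPrime_iff.1 hp
  have hx : x ∈ (⊥ : Submodule R M).idealColon a := fun r hra => by
    simpa [Submodule.mem_colon_singleton] using hap hra
  rw [h, Submodule.mem_bot] at hx
  subst hx
  exact hp'.ne_top (by ext; simp [Submodule.mem_colon_singleton])

theorem exists_forall_idealColon_pow_le {R M : Type*} [CommRing R] [AddCommGroup M] [Module R M]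
    [IsNoetherian R M] (a : Ideal R) : ∃ k, ∀ n, (⊥ : Submodule R M).idealColon (a ^ n) ≤
      (⊥ : Submodule R M).idealColon (a ^ k) := by
  obtain ⟨k, hk⟩ := monotone_stabilizes_iff_noetherian.2 ‹IsNoetherian R M›
    ⟨fun n => (⊥ : Submodule R M).idealColon (a ^ n),
      fun m n h x hx r hr => hx r (Ideal.pow_le_pow_right h hr)⟩
  refine ⟨k, fun n x hx => ?_⟩
  have : (⊥ : Submodule R M).idealColon (a ^ k) = (⊥ : Submodule R M).idealColon (a ^ max k n) :=
    hk (max k n) (le_max_left k n)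
  rw [this]
  exact fun r hr => hx r (Ideal.pow_le_pow_right (le_max_right k n) hr)

theorem SFinite.idealColon_bot_of_injective {R A B : Type*} [CommRing R] [IsNoetherianRing R]
    {S : Submonoid R} [AddCommGroup A] [Module R A] [AddCommGroup B] [Module R B] {J : Ideal R}
    (h : SFinite S ((⊥ : Submodule R B).idealColon J)) (f : A →ₗ[R] B)
    (hf : Function.Injective f) : SFinite S ((⊥ : Submodule R A).idealColon J) := by
  refine h.of_injective (f.restrict (p := (⊥ : Submodule R A).idealColon J)
    fun x hx r hr => ?_) fun x y hxy => Subtype.ext (hf (congrArg Subtype.val hxy))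
  rw [← map_smul, (Submodule.mem_bot R).1 (hx r hr), map_zero]
  exact zero_mem _

variable {R : Type u} [CommRing R] [IsNoetherianRing R] {a : Ideal R} {S : Submonoid R}

theorem SFinite.powExt_quotSMulTop {i : ℕ} {M : Type u} [AddCommGroup M] [Module R M] {x : R}
    (hx : IsSMulRegular M x) (h : SFinite S (PowExt a (ModuleCat.of R M) i))
    (h' : SFinite S (PowExt a (ModuleCat.of R M) (i + 1))) :
    SFinite S (PowExt a (ModuleCat.of R (QuotSMulTop x M)) i) := by
  have hE : ((ModuleCat.of R M).smulShortComplex x).ShortExact :=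
    IsSMulRegular.smulShortComplex_shortExact hx
  exact SFinite.of_exact (A := PowExt a ((ModuleCat.of R M).smulShortComplex x).X₂ i)
    (B := PowExt a ((ModuleCat.of R M).smulShortComplex x).X₃ i)
    (C := PowExt a ((ModuleCat.of R M).smulShortComplex x).X₁ (i + 1)) h h' _ _
    fun y hy => PowExt.exact₃ hE y hy

/-- The elements killed by `J` in the target of a connecting map. -/
theorem SFinite.idealColon_of_exact {A B C : Type*} [AddCommGroup A] [Module R A]
    [AddCommGroup B] [Module R B] [AddCommGroup C] [Module R C] {J : Ideal R}
    (hB : SFinite S B) (hC : SFinite S ((⊥ : Submodule R C).idealColon J))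
    (f : B →ₗ[R] C) (δ : C →ₗ[R] A) (hf : ∀ y, δ y = 0 → ∃ x, f x = y)
    (hδ : ∀ y ∈ (⊥ : Submodule R A).idealColon J, ∃ x, δ x = y) :
    SFinite S ((⊥ : Submodule R A).idealColon J) := by
  have hrange : SFinite S (LinearMap.range f) :=
    hB.of_surjective f.rangeRestrict f.surjective_rangeRestrict
  refine ((hrange.idealColon hC).of_surjective (δ.submoduleMap _)
    (δ.submoduleMap_surjective _)).submodule_mono fun y hy => ?_
  obtain ⟨z, rfl⟩ := hδ y hy
  refine ⟨z, fun r hr => hf _ ?_, rfl⟩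
  rw [map_smul]
  exact (Submodule.mem_bot R).1 (hy r hr)

theorem SFinite.idealColon_powExt_succ {i : ℕ} {M : Type u} [AddCommGroup M] [Module R M] {x : R}
    (hx : IsSMulRegular M x) (hxa : x ∈ a) (h : SFinite S (PowExt a (ModuleCat.of R M) i))
    (h' : SFinite S
      ((⊥ : Submodule R (PowExt a (ModuleCat.of R (QuotSMulTop x M)) i)).idealColon a)) :
    SFinite S ((⊥ : Submodule R (PowExt a (ModuleCat.of R M) (i + 1))).idealColon a) := by
  have hE : ((ModuleCat.of R M).smulShortComplex x).ShortExact :=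
    IsSMulRegular.smulShortComplex_shortExact hx
  refine SFinite.idealColon_of_exact
    (A := PowExt a ((ModuleCat.of R M).smulShortComplex x).X₁ (i + 1))
    (B := PowExt a ((ModuleCat.of R M).smulShortComplex x).X₂ i)
    (C := PowExt a ((ModuleCat.of R M).smulShortComplex x).X₃ i) h h' _ _
    (fun y hy => PowExt.exact₃ hE y hy) fun y hy => PowExt.exact₁ hE y ?_
  exact (PowExt.postcomp_smul_id (M := ModuleCat.of R M) x y).trans
    ((Submodule.mem_bot R).1 (hy x hxa))

theorem SFinite.idealColon_powExt {t : ℕ} {M : Type u} [AddCommGroup M] [Module R M]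
    [Module.Finite R M] (h : ∀ i < t, SFinite S (PowExt a (ModuleCat.of R M) i)) :
    SFinite S ((⊥ : Submodule R (PowExt a (ModuleCat.of R M) t)).idealColon a) := by
  induction t generalizing M with
  | zero =>
    obtain ⟨f, hf⟩ := PowExt.exists_injective_zero a (ModuleCat.of R M)
    have : SFinite S (ModuleCat.of R M) := SFinite.of_finite S (A := M)
    exact (this.of_injective f hf).of_injective (Submodule.subtype _) Subtype.val_injective
  | succ t ih =>
    obtain ⟨k, hk⟩ := exists_forall_idealColon_pow_le (M := M) a
    set Γ := (⊥ : Submodule R M).idealColon (a ^ k) with hΓ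
    have hE := LinearMap.shortExact_shortComplexKer Γ.mkQ_surjective
    have hvan (i : ℕ) (x : PowExt a Γ.mkQ.shortComplexKer.X₁ (i + 1)) : x = 0 := by
      refine PowExt.eq_zero_of_pow_smul_eq_zero (k := k) (fun r hr m => ?_) x
      obtain ⟨m, hm⟩ := m
      rw [Submodule.ker_mkQ] at hm
      exact Subtype.ext ((Submodule.mem_bot R).1 (hm r hr))
    have hfin (i : ℕ) (hi : i < t + 1) : SFinite S (PowExt a (ModuleCat.of R (M ⧸ Γ)) i) :=
      (h i hi).of_surjective (PowExt.postcomp a (Ext.mk₀ Γ.mkQ.shortComplexKer.g) (add_zero i))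
        fun y => PowExt.exact₃ hE y (hvan _ _)
    have hinj : Function.Injective (PowExt.postcomp a (Ext.mk₀ Γ.mkQ.shortComplexKer.g)
        (add_zero (t + 1))) := by
      rw [injective_iff_map_eq_zero]
      intro x hx
      obtain ⟨y, rfl⟩ := PowExt.exact₂ hE x hx
      rw [hvan _ y, map_zero]
    refine SFinite.idealColon_bot_of_injective (B := PowExt a (ModuleCat.of R (M ⧸ Γ)) (t + 1))
      ?_ _ hinj
    have hcolon : (⊥ : Submodule R (M ⧸ Γ)).idealColon a = ⊥ := by
      rw [eq_bot_iff]
      intro y hy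
      obtain ⟨x, rfl⟩ := Γ.mkQ_surjective y
      rw [Submodule.mem_bot, Submodule.mkQ_apply, Submodule.Quotient.mk_eq_zero]
      refine hk (k + 1) fun r hr => ?_
      rw [pow_succ] at hr
      refine Submodule.mul_induction_on hr (fun r hr r' hr' => ?_) fun r r' h h' => ?_
      · rw [mul_smul]
        have := (Submodule.mem_bot R).1 (hy r' hr')
        rw [← map_smul, Submodule.mkQ_apply, Submodule.Quotient.mk_eq_zero] at this
        exact this r hr
      · rw [add_smul]
        exact add_mem h h'
    obtain ⟨x, hxa, hx⟩ := exists_isSMulRegular_of_idealColon_bot hcolon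
    exact SFinite.idealColon_powExt_succ hx hxa (hfin t t.lt_succ_self) <|
      ih (M := QuotSMulTop x (M ⧸ Γ)) fun i hi =>
        SFinite.powExt_quotSMulTop hx (hfin i (by lia)) (hfin (i + 1) (by lia))

theorem SFinite.powExt {t : ℕ} {M : Type u} [AddCommGroup M] [Module R M] [Module.Finite R M]
    (h : ∀ i ≤ t, ∀ (p : Ideal R) [p.IsPrime], (∀ s ∈ S, s ∉ p) →
      SFinite p.primeCompl (PowExt a (ModuleCat.of R M) i)) :
    ∀ i ≤ t, SFinite S (PowExt a (ModuleCat.of R M) i) := by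
  intro i
  induction i using Nat.strong_induction_on with
  | _ i ih =>
    intro hi
    refine SFinite.of_forall_prime (a := a) (fun x => ?_)
      (SFinite.idealColon_powExt fun j hj => ih j hj (by lia)) fun p _ hS => h i hi p hS
    obtain ⟨k, hk⟩ := PowExt.exists_forall_smul_eq_zero x
    exact ⟨k, fun r hr => hk r hr⟩

end Finiteness

theorem localGlobal_localized_finite (R M : Type u) [CommRing R] [IsNoetherianRing R]
    [AddCommGroup M] [Module R M] [Module.Finite R M] (a : Ideal R) (S : Submonoid R) (t : ℕ)
    (h : ∀ i ≤ t, ∀ p : PrimeSpectrum R, (∀ s ∈ S, s ∉ p.asIdeal) →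
      Module.Finite (Localization.AtPrime p.asIdeal)
        (LocalizedModule p.asIdeal.primeCompl ((localCohomology a i).obj (ModuleCat.of R M)))) :
    ∀ i ≤ t, Module.Finite (Localization S)
      (LocalizedModule S ((localCohomology a i).obj (ModuleCat.of R M))) := by
  have e (i : ℕ) := (exists_powExt_equiv_localCohomology a i (ModuleCat.of R M)).some
  have key := SFinite.powExt (S := S) (a := a) (M := M) (t := t) fun i hi p _ hp =>
    (SFinite.of_module_finite_localizedModule (S := p.primeCompl)
      (h i hi ⟨p, inferInstance⟩ hp)).of_surjective (e i).symm.toLinearMap (e i).symm.surjective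
  exact fun i hi =>
    ((key i hi).of_surjective (e i).toLinearMap (e i).surjective).module_finite_localizedModule
end

section
/- Let R be a commutative Noetherian ring and M a weakly Laskerian R-module (i.e., Ass_R(M/N) is finite for every submodule N ⊆ M). Then there exists a finitely generated submodule N of M such that dim Supp(M/N) ≤ 1; that is, M is in dimension < 2. -/
open CategoryTheory

universe u

section
variable {R : Type u} [CommRing R]

theorem Module.support_quotient_anti {M : Type u} [AddCommGroup M] [Module R M]
    {N N' : Submodule R M} (h : N ≤ N') :
    Module.support R (M ⧸ N') ⊆ Module.support R (M ⧸ N) :=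
  Module.support_subset_of_surjective _ (Submodule.factor_surjective h)

variable [IsNoetherianRing R]

/-- If there is a chain `p < p₁ < p₂` of primes in a Noetherian ring, then no element outside `p`
lies in every prime strictly above `p`. -/
theorem PrimeSpectrum.exists_lt_notMem {p p₁ p₂ : PrimeSpectrum R} (h₁ : p < p₁) (h₂ : p₁ < p₂)
    {s : R} (hs : s ∉ p.asIdeal) : ∃ q : PrimeSpectrum R, p < q ∧ s ∉ q.asIdeal := by
  by_contra! H
  have hmono : StrictMono fun q : PrimeSpectrum R ↦ q.asIdeal.height :=
    fun _ _ h ↦ Ideal.height_strict_mono_of_isPrime_of_isPrime h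
  have := hmono.wellFoundedLT
  obtain ⟨m, ⟨m₁, hm₁, hm₂⟩, hmin⟩ := exists_minimal_of_wellFoundedLT
    (fun m : PrimeSpectrum R ↦ ∃ m₁, p < m₁ ∧ m₁ < m) ⟨p₂, p₁, h₁, h₂⟩
  let S := {r ∈ (p.asIdeal ⊔ Ideal.span {s}).minimalPrimes | r < m.asIdeal}
  have hS : S.Finite :=
    (Ideal.finite_minimalPrimes_of_isNoetherianRing R _).subset (Set.sep_subset _ _)
  have hcover : (m.asIdeal : Set R) ⊆ ⋃ r ∈ S, (r : Set R) := by
    intro t ht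
    obtain ⟨q, htq, hpq, hqm⟩ := PrimeSpectrum.exist_mem_one_of_mem_two hm₁ hm₂ ht
    obtain ⟨r, hr, hrq⟩ := Ideal.exists_minimalPrimes_le (J := q.asIdeal) <|
      sup_le hpq.le <| (Ideal.span_singleton_le_iff_mem _).2 (H q hpq)
    have hsr : s ∈ r := hr.1.2 (Ideal.mem_sup_right (Ideal.mem_span_singleton_self s))
    have hpr : p.asIdeal < r :=
      lt_of_le_of_ne (le_sup_left.trans hr.1.2) fun h ↦ hs (h ▸ hsr)
    obtain rfl : r = q.asIdeal := by
      by_contra hne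
      exact hqm.not_ge (hmin ⟨⟨r, hr.1.1⟩, hpr, lt_of_le_of_ne hrq fun e ↦
        hne (congrArg PrimeSpectrum.asIdeal e)⟩ hqm.le)
    exact Set.mem_biUnion (show q.asIdeal ∈ S from ⟨hr, hqm⟩) htq
  obtain ⟨r, hr, hmr⟩ := (Ideal.subset_union_prime_finite hS ⊥ ⊥ fun i hi _ _ ↦ hi.1.1.1).1 hcover
  exact hr.2.not_ge hmr

/-- A form of Krull's intersection theorem: if `x ∉ N` locally at `q ∋ s`, then `x ∉ N + R sⁿ y`
locally at `q` for some `n`. -/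
theorem exists_localized_notMem {M : Type u} [AddCommGroup M] [Module R M] (N : Submodule R M)
    (q : Ideal R) [q.IsPrime] {s : R} (hs : s ∈ q) (x y : M) (hx : ∀ t ∉ q, t • x ∉ N) :
    ∃ n, ∀ t ∉ q, t • x ∉ N ⊔ R ∙ (s ^ n • y) := by
  by_contra! H
  let A := Localization.AtPrime q
  let E := LocalizedModule q.primeCompl (M ⧸ N)
  let f := LocalizedModule.mkLinearMap q.primeCompl (M ⧸ N)
  let u : E := f (N.mkQ x)
  let v : E := f (N.mkQ y)
  let G := Submodule.span A {v}
  have key : ∀ n : ℕ, ∃ a : A, u = a • (algebraMap R A s) ^ n • v := by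
    intro n
    obtain ⟨t, ht, hmem⟩ := H n
    obtain ⟨b, hb, c, hc, hbc⟩ := Submodule.mem_sup.1 hmem
    obtain ⟨r, rfl⟩ := Submodule.mem_span_singleton.1 hc
    have h1 : t • N.mkQ x = r • s ^ n • N.mkQ y := by
      rw [← map_smul, ← hbc, map_add]
      simp [(Submodule.Quotient.mk_eq_zero N).2 hb]
    have h2 : algebraMap R A t • u = algebraMap R A r • algebraMap R A s ^ n • v := by
      rw [← map_pow, algebraMap_smul, algebraMap_smul, algebraMap_smul, ← f.map_smul, ← f.map_smul,
        ← f.map_smul, h1]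
    obtain ⟨i, hi⟩ := IsLocalization.map_units A (⟨t, ht⟩ : q.primeCompl)
    refine ⟨(↑i⁻¹ : A) * algebraMap R A r, ?_⟩
    rw [mul_smul, ← h2, ← mul_smul]
    simp only at hi
    rw [← hi]
    simp
  have hu : u ∈ G := by
    obtain ⟨a, ha⟩ := key 0
    rw [ha]
    simpa [G] using G.smul_mem a (Submodule.mem_span_singleton_self v)
  have hu0 : (⟨u, hu⟩ : G) ∈ (⨅ i : ℕ, IsLocalRing.maximalIdeal A ^ i • ⊤ : Submodule A G) := by
    rw [Submodule.mem_iInf]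
    intro n
    obtain ⟨a, ha⟩ := key n
    have : (⟨u, hu⟩ : G) =
        (a * algebraMap R A s ^ n) • ⟨v, Submodule.mem_span_singleton_self v⟩ := by
      ext; simp [ha, mul_smul]
    rw [this]
    refine Submodule.smul_mem_smul (Ideal.mul_mem_left _ _ (Ideal.pow_mem_pow ?_ _)) trivial
    rwa [IsLocalization.AtPrime.to_map_mem_maximal_iff A q]
  rw [Ideal.iInf_pow_smul_eq_bot_of_isLocalRing (M := G) _ Ideal.IsPrime.ne_top',
    Submodule.mem_bot] at hu0
  have : f (N.mkQ x) = 0 := congrArg Subtype.val hu0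
  obtain ⟨t, ht⟩ := (IsLocalizedModule.eq_zero_iff q.primeCompl f).1 this
  exact hx t t.2 ((Submodule.Quotient.mk_eq_zero N).1 ht)

/-- Every prime in the support contains an associated prime. -/
theorem exists_associatedPrime_le {M : Type u} [AddCommGroup M] [Module R M] {q : PrimeSpectrum R}
    (hq : q ∈ Module.support R M) : ∃ P ∈ associatedPrimes R M, P ≤ q.asIdeal := by
  obtain ⟨m, hm⟩ := Module.mem_support_iff_exists_annihilator.1 hq
  obtain ⟨P, hP, hPq⟩ := Ideal.exists_minimalPrimes_le hm
  exact ⟨P, IsAssociatedPrime.map_of_injective (f := (R ∙ m).subtype)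
    (Module.associatedPrimes.minimalPrimes_annihilator_subset_associatedPrimes R _ hP)
    (R ∙ m).injective_subtype, hPq⟩

theorem exists_fg_forall_le_of_forall_notMem_support {M : Type u} [AddCommGroup M] [Module R M]
    (h : ∀ N : Submodule R M, (associatedPrimes R (M ⧸ N)).Finite)
    (hp : ∀ p p₁ p₂ : PrimeSpectrum R, p < p₁ → p₁ < p₂ →
      ∃ N : Submodule R M, N.FG ∧ p ∉ Module.support R (M ⧸ N)) (I : Ideal R) :
    ∃ N : Submodule R M, N.FG ∧ ∀ q ∈ Module.support R (M ⧸ N), I ≤ q.asIdeal →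
      ∀ q₁ q₂, q < q₁ → ¬ q₁ < q₂ := by
  induction I using WellFoundedGT.induction with
  | ind I ih =>
  by_cases hI : I.IsPrime
  · let p : PrimeSpectrum R := ⟨I, hI⟩
    by_cases hc : ∃ p₁ p₂, p < p₁ ∧ p₁ < p₂
    · obtain ⟨p₁, p₂, h₁, h₂⟩ := hc
      obtain ⟨N, hN, hpN⟩ := hp p p₁ p₂ h₁ h₂
      let J : Ideal R := ∏ P ∈ (h N).toFinset, P
      have hJ : ¬ J ≤ I := by
        intro hJ
        obtain ⟨P, hP, hPI⟩ := (Ideal.IsPrime.prod_le hI).1 hJ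
        have hP' : IsAssociatedPrime P (M ⧸ N) := (h N).mem_toFinset.1 hP
        obtain ⟨-, x, hx⟩ := isAssociatedPrime_iff.1 hP'
        refine hpN (Module.mem_support_iff_exists_annihilator.2 ⟨x, fun t ht ↦ hPI ?_⟩)
        rw [hx, Submodule.mem_colon_singleton]
        simpa [Submodule.mem_annihilator_span_singleton] using ht
      obtain ⟨N', hN', hq⟩ := ih (I ⊔ J) (left_lt_sup.2 hJ)
      refine ⟨N ⊔ N', hN.sup hN', fun q hqs hIq ↦
        hq q (Module.support_quotient_anti le_sup_right hqs) (sup_le hIq ?_)⟩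
      obtain ⟨P, hP, hPq⟩ :=
        exists_associatedPrime_le (Module.support_quotient_anti le_sup_left hqs)
      exact (Ideal.IsPrime.prod_le q.2).2 ⟨P, (h N).mem_toFinset.2 hP, hPq⟩
    · exact ⟨⊥, Submodule.fg_bot, fun q _ hIq q₁ q₂ h₁ h₂ ↦
        hc ⟨q₁, q₂, lt_of_le_of_lt (show p ≤ q from hIq) h₁, h₂⟩⟩
  · rcases Ideal.not_isPrime_iff.1 hI with rfl | ⟨a, ha, b, hb, hab⟩
    · exact ⟨⊥, Submodule.fg_bot, fun q _ hq ↦ (q.2.ne_top (top_le_iff.1 hq)).elim⟩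
    · have hlt {c : R} (hc : c ∉ I) : I < I ⊔ Ideal.span {c} :=
        left_lt_sup.2 (by rwa [Ideal.span_singleton_le_iff_mem])
      obtain ⟨N, hN, hqN⟩ := ih _ (hlt ha)
      obtain ⟨N', hN', hqN'⟩ := ih _ (hlt hb)
      refine ⟨N ⊔ N', hN.sup hN', fun q hqs hIq ↦ ?_⟩
      rcases q.2.mem_or_mem (hIq hab) with hq | hq
      · exact hqN q (Module.support_quotient_anti le_sup_left hqs)
          (sup_le hIq ((Ideal.span_singleton_le_iff_mem _).2 hq))
      · exact hqN' q (Module.support_quotient_anti le_sup_right hqs)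
          (sup_le hIq ((Ideal.span_singleton_le_iff_mem _).2 hq))

/-- A finitely generated submodule `N` together with finitely many pairs `(q, x)` such that `q`
is a prime strictly above `p` and is exactly the annihilator of `x` modulo `N`. -/
structure AnnihilatorWitness (p : PrimeSpectrum R) (M : Type u) [AddCommGroup M] [Module R M] where
  submodule : Submodule R M
  pairs : Finset (PrimeSpectrum R × M)
  fg : submodule.FG
  lt_fst : ∀ a ∈ pairs, p < a.1
  smul_mem_iff : ∀ a ∈ pairs, ∀ t : R, t • a.2 ∈ submodule ↔ t ∈ a.1.asIdeal

theorem AnnihilatorWitness.exists_extension {M : Type u} [AddCommGroup M] [Module R M]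
    {p p₁ p₂ : PrimeSpectrum R} (h₁ : p < p₁) (h₂ : p₁ < p₂)
    (hp : ∀ N : Submodule R M, N.FG → p ∈ Module.support R (M ⧸ N))
    (w : AnnihilatorWitness p M) :
    ∃ w' : AnnihilatorWitness p M, w.submodule ≤ w'.submodule ∧ w.pairs ⊆ w'.pairs ∧
      ∃ a ∈ w'.pairs, ∀ b ∈ w.pairs, a.1 ≠ b.1 := by
  classical
  obtain ⟨s, hs, hsp⟩ : ∃ s ∈ ∏ a ∈ w.pairs, a.1.asIdeal, s ∉ p.asIdeal := by
    by_contra! H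
    obtain ⟨a, ha, hap⟩ := (Ideal.IsPrime.prod_le p.2).1 H
    exact (w.lt_fst a ha).not_ge hap
  obtain ⟨q, hpq, hsq⟩ := PrimeSpectrum.exists_lt_notMem h₁ h₂ hsp
  have hsa (a) (ha : a ∈ w.pairs) : s ∈ a.1.asIdeal :=
    (Ideal.IsPrime.prod_le a.1.2).2 ⟨a, ha, le_rfl⟩ hs
  obtain ⟨y, hy⟩ := Module.mem_support_iff_exists_annihilator.1
    (Module.mem_support_mono hpq.le (hp _ w.fg))
  obtain ⟨y, rfl⟩ := w.submodule.mkQ_surjective y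
  have hyq (t : R) (ht : t • y ∈ w.submodule) : t ∈ q.asIdeal := hy <| by
    rw [Submodule.mem_annihilator_span_singleton, ← map_smul]
    exact (Submodule.Quotient.mk_eq_zero _).2 ht
  have hn : ∀ a ∈ w.pairs, ∀ᶠ n in Filter.atTop, ∀ t ∉ a.1.asIdeal,
      t • a.2 ∉ w.submodule ⊔ R ∙ (s ^ n • y) := by
    intro a ha
    obtain ⟨n, hn⟩ := exists_localized_notMem w.submodule a.1.asIdeal (hsa a ha) a.2 y
      fun t ht ↦ (w.smul_mem_iff a ha t).not.2 ht
    filter_upwards [Filter.eventually_ge_atTop n] with m hm t ht hmem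
    have hle : R ∙ (s ^ m • y) ≤ R ∙ (s ^ n • y) := by
      rw [Submodule.span_singleton_le_iff_mem, ← Nat.sub_add_cancel hm, pow_add, mul_smul]
      exact Submodule.smul_mem _ _ (Submodule.mem_span_singleton_self _)
    exact hn t ht ((sup_le_sup_left hle w.submodule : _ ≤ _) hmem)
  obtain ⟨n, hn⟩ := ((Filter.eventually_all_finset w.pairs).2 hn).exists
  let z := s ^ n • y
  have hN : w.submodule ⊔ q.asIdeal • (R ∙ z) ≤ w.submodule ⊔ R ∙ z :=
    sup_le_sup_left Submodule.smul_le_right _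
  refine ⟨⟨w.submodule ⊔ q.asIdeal • (R ∙ z), insert (q, z) w.pairs,
    w.fg.sup (Submodule.FG.smul (IsNoetherian.noetherian q.asIdeal)
      (Submodule.fg_span_singleton z)), ?_, ?_⟩,
    le_sup_left, Finset.subset_insert _ _, (q, z), Finset.mem_insert_self _ _, ?_⟩
  · simpa [hpq] using w.lt_fst
  · intro a ha t
    rcases Finset.mem_insert.1 ha with rfl | ha
    · refine ⟨fun ht ↦ ?_, fun ht ↦ Submodule.mem_sup_right
        (Submodule.smul_mem_smul ht (Submodule.mem_span_singleton_self z))⟩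
      obtain ⟨b, hb, c, hc, hbc⟩ := Submodule.mem_sup.1 ht
      obtain ⟨r, hr, rfl⟩ := Submodule.mem_smul_span_singleton.1 hc
      have hmem : ((t - r) * s ^ n) • y ∈ w.submodule := by
        rwa [mul_smul, sub_smul, ← hbc, add_sub_cancel_right]
      have hsub := (q.2.mem_or_mem (hyq _ hmem)).resolve_right
        fun h ↦ hsq (q.2.mem_of_pow_mem n h)
      simpa using q.asIdeal.add_mem hsub hr
    · exact ⟨fun ht ↦ by_contra fun h ↦ hn a ha t h (hN ht),
        fun ht ↦ Submodule.mem_sup_left ((w.smul_mem_iff a ha t).2 ht)⟩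
  · rintro b hb rfl
    exact hsq (hsa b hb)

/-- If `p < p₁ < p₂` and `p` lies in the support of `M/N` for every finitely generated `N`, then
some quotient of `M` has infinitely many associated primes. -/
theorem exists_infinite_associatedPrimes {M : Type u} [AddCommGroup M] [Module R M]
    {p p₁ p₂ : PrimeSpectrum R} (h₁ : p < p₁) (h₂ : p₁ < p₂)
    (hp : ∀ N : Submodule R M, N.FG → p ∈ Module.support R (M ⧸ N)) :
    ∃ K : Submodule R M, (associatedPrimes R (M ⧸ K)).Infinite := by
  choose f hle hsub a ha hne using
    AnnihilatorWitness.exists_extension (M := M) h₁ h₂ hp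
  let w (n : ℕ) : AnnihilatorWitness p M := f^[n] ⟨⊥, ∅, Submodule.fg_bot, by simp, by simp⟩
  have hw (n : ℕ) : w (n + 1) = f (w n) := Function.iterate_succ_apply' f n _
  have hmono : Monotone fun n ↦ (w n).submodule :=
    monotone_nat_of_le_succ fun n ↦ by simpa only [hw] using hle (w n)
  have hpairs : Monotone fun n ↦ (w n).pairs :=
    monotone_nat_of_le_succ fun n ↦ by simpa only [hw] using hsub (w n)
  have hmem (n : ℕ) : a (w n) ∈ (w (n + 1)).pairs := by simpa only [hw] using ha (w n)
  refine ⟨⨆ n, (w n).submodule, Set.infinite_of_injective_forall_mem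
    (f := fun n ↦ (a (w n)).1.asIdeal) ?_ fun n ↦ ?_⟩
  · refine Function.Injective.of_lt_imp_ne fun m n hmn h ↦ ?_
    exact hne (w n) _ (hpairs hmn (hmem m)) (PrimeSpectrum.ext h.symm)
  · refine isAssociatedPrime_iff.2 ⟨(a (w n)).1.2, Submodule.mkQ _ (a (w n)).2, ?_⟩
    ext t
    rw [Submodule.mem_colon_singleton, ← map_smul, Submodule.mem_bot, Submodule.mkQ_apply,
      Submodule.Quotient.mk_eq_zero, Submodule.mem_iSup_of_directed _ hmono.directed_le]
    refine ⟨fun ht ↦ ⟨n + 1, ((w (n + 1)).smul_mem_iff _ (hmem n) t).2 ht⟩, fun ⟨m, hm⟩ ↦ ?_⟩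
    exact ((w (max m (n + 1))).smul_mem_iff _ (hpairs (le_max_right _ _) (hmem n)) t).1
      (hmono (le_max_left _ _) hm)

end

theorem weaklyLaskerian_inDimLT_two (R M : Type u) [CommRing R] [IsNoetherianRing R]
    [AddCommGroup M] [Module R M]
    (h : ∀ N : Submodule R M, (associatedPrimes R (M ⧸ N)).Finite) :
    InDimLT R M 2 := by
  obtain ⟨N, hN, hq⟩ := exists_fg_forall_le_of_forall_notMem_support h (fun p p₁ p₂ h₁ h₂ ↦ by
    by_contra! hp
    obtain ⟨K, hK⟩ := exists_infinite_associatedPrimes h₁ h₂ hp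
    exact hK (h K)) ⊥
  refine ⟨N, hN, lt_of_not_ge fun hle ↦ ?_⟩
  obtain ⟨l, hl⟩ := Order.le_krullDim_iff.1 hle
  exact hq (l ⟨0, by omega⟩) (l ⟨0, by omega⟩).2 bot_le (l ⟨1, by omega⟩) (l ⟨2, by omega⟩)
    (l.strictMono (Fin.mk_lt_mk.2 one_pos)) (l.strictMono (Fin.mk_lt_mk.2 one_lt_two))
end

section
/- Let R be a commutative Noetherian ring, a an ideal, M a finitely generated R-module, and n a nonnegative integer. Then f^0_a(M) = f_a(M), i.e., inf{ f_{aR_p}(M_p) : p ∈ Supp(M/aM), dim R/p ≥ 0 } equals inf{ i : H^i_a(M) is not finitely generated }. -/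
open CategoryTheory

universe u

section ShortComplexModule
variable {R : Type u} [Ring R]

/-- The class in homology of an element of the kernel. -/
noncomputable def homologyClass (S : ShortComplex (ModuleCat.{u} R)) :
    LinearMap.ker S.g.hom →ₗ[R] S.homology :=
  (S.moduleCatCyclesIso.inv ≫ S.homologyπ).hom

lemma homologyClass_surjective (S : ShortComplex (ModuleCat.{u} R)) :
    Function.Surjective (homologyClass S) :=
  (ModuleCat.epi_iff_surjective (S.moduleCatCyclesIso.inv ≫ S.homologyπ)).1 (epi_comp _ _)

lemma homologyClass_eq_zero_iff (S : ShortComplex (ModuleCat.{u} R))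
    (z : LinearMap.ker S.g.hom) :
    homologyClass S z = 0 ↔ ∃ x, S.f.hom x = z.1 := by
  have h : Function.Injective S.moduleCatHomologyIso.inv.hom :=
    (ModuleCat.mono_iff_injective _).1 inferInstance
  have e : homologyClass S = (S.moduleCatLeftHomologyData.π ≫ S.moduleCatHomologyIso.inv).hom :=
    congrArg ModuleCat.Hom.hom S.moduleCatCyclesIso_inv_π
  rw [e]
  refine (map_eq_zero_iff S.moduleCatHomologyIso.inv.hom h).trans ?_
  change Submodule.Quotient.mk z = 0 ↔ _
  rw [Submodule.Quotient.mk_eq_zero]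
  constructor
  · rintro ⟨x, rfl⟩
    exact ⟨x, rfl⟩
  · rintro ⟨x, hx⟩
    exact ⟨x, Subtype.ext hx⟩

lemma homologyMap_homologyClass {S T : ShortComplex (ModuleCat.{u} R)} (φ : S ⟶ T)
    (z : LinearMap.ker S.g.hom) (w : LinearMap.ker T.g.hom) (h : φ.τ₂.hom z.1 = w.1) :
    (ShortComplex.homologyMap φ).hom (homologyClass S z) = homologyClass T w := by
  have e : (ShortComplex.cyclesMap φ).hom (S.moduleCatCyclesIso.inv.hom z) =
      T.moduleCatCyclesIso.inv.hom w := by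
    apply (ModuleCat.mono_iff_injective T.iCycles).1 inferInstance
    have h1 := congr($(ShortComplex.cyclesMap_i φ) (S.moduleCatCyclesIso.inv z))
    have h2 : S.iCycles.hom (S.moduleCatCyclesIso.inv.hom z) = z.1 :=
      congr($(S.moduleCatCyclesIso_inv_iCycles) z)
    have h3 : T.iCycles.hom (T.moduleCatCyclesIso.inv.hom w) = w.1 :=
      congr($(T.moduleCatCyclesIso_inv_iCycles) w)
    simp only [ModuleCat.comp_apply] at h1
    exact h1.trans ((congrArg φ.τ₂.hom h2).trans (h.trans h3.symm))
  have h1 := congr($(ShortComplex.homologyπ_naturality φ) (S.moduleCatCyclesIso.inv z))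
  simp only [ModuleCat.comp_apply] at h1
  refine h1.trans ?_
  exact congrArg (T.homologyπ) e

end ShortComplexModule

section ExtComparison
variable {R : Type u} [CommRing R]

/-- Degree `n` cocycles with values in `Y` of a projective resolution. -/
noncomputable def CategoryTheory.ProjectiveResolution.cocycles {X : ModuleCat.{u} R}
    (P : ProjectiveResolution X) (Y : ModuleCat.{u} R) (n : ℕ) :
    Submodule R (P.complex.X n ⟶ Y) :=
  LinearMap.ker (Linear.leftComp R Y (P.complex.d (n + 1) n))

/-- The cochain map on Hom complexes induced by a chain map. -/
noncomputable def linearYonedaObjMap {K L : ChainComplex (ModuleCat.{u} R) ℕ} (φ : K ⟶ L)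
    (Y : ModuleCat.{u} R) :
    L.linearYonedaObj R Y ⟶ K.linearYonedaObj R Y :=
  (HomologicalComplex.unopFunctor _ _).map
    ((((linearYoneda R (ModuleCat.{u} R)).obj Y).rightOp.mapHomologicalComplex _).map φ).op

lemma homologyUnop_hom_comp_homologyMap_unop {V ι : Type*} [Category V] [Abelian V]
    {c : ComplexShape ι} {K L : HomologicalComplex Vᵒᵖ c} (φ : K ⟶ L) (n : ι) :
    (HomologicalComplex.homologyUnop L n).hom ≫ (HomologicalComplex.homologyMap φ n).unop =
        HomologicalComplex.homologyMap ((HomologicalComplex.unopFunctor V c).map φ.op) n ≫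
      (HomologicalComplex.homologyUnop K n).hom :=
  (congrArg Quiver.Hom.unop (HomologicalComplex.homologyOp_hom_naturality
    ((HomologicalComplex.unopFunctor V c).map φ.op) n))

lemma isoExt_inv_naturality {X X' : ModuleCat.{u} R} (g : X' ⟶ X)
    (P : ProjectiveResolution X) (P' : ProjectiveResolution X')
    (φ : ProjectiveResolution.Hom P' P g) (Y : ModuleCat.{u} R) (n : ℕ) :
    (P.isoExt n Y).inv ≫ ((Ext R (ModuleCat.{u} R) n).map g.op).app Y =
      HomologicalComplex.homologyMap (linearYonedaObjMap φ.hom Y) n ≫ (P'.isoExt n Y).inv := by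
  let F := ((linearYoneda R (ModuleCat.{u} R)).obj Y).rightOp
  let ψ := (F.mapHomologicalComplex (ComplexShape.down ℕ)).map φ.hom
  have h1 : (P.isoLeftDerivedObj F n).hom.unop ≫ ((F.leftDerived n).map g).unop =
      (HomologicalComplex.homologyMap ψ n).unop ≫ (P'.isoLeftDerivedObj F n).hom.unop :=
    congrArg Quiver.Hom.unop (ProjectiveResolution.isoLeftDerivedObj_hom_naturality g P' P φ.hom
      φ.hom_f_zero_comp_π_f_zero F n)
  have h2 := homologyUnop_hom_comp_homologyMap_unop ψ n
  have aux : ∀ {A B C D E G : ModuleCat.{u} R} {a : A ⟶ B} {b : B ⟶ C} {c : C ⟶ G} {d : B ⟶ D}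
      {e : D ⟶ G} {p : A ⟶ E} {q : E ⟶ D}, b ≫ c = d ≫ e → a ≫ d = p ≫ q →
      (a ≫ b) ≫ c = p ≫ q ≫ e := by
    intro A B C D E G a b c d e p q h h'
    rw [Category.assoc, h, ← Category.assoc, h', Category.assoc]
  exact aux h1 h2

variable {X : ModuleCat.{u} R} (P : ProjectiveResolution X) (Y : ModuleCat.{u} R) (n : ℕ)

lemma cocycles_eq_ker : P.cocycles Y n =
    LinearMap.ker ((P.complex.linearYonedaObj R Y).sc n).g.hom := by
  ext f
  change P.complex.d (n + 1) n ≫ f = 0 ↔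
    P.complex.d ((ComplexShape.up ℕ).next n) n ≫ f = 0
  rw [CochainComplex.next]

/-- The class in `Ext` (defined by derived functors) of a cocycle. -/
noncomputable def leftDerivedExtClass : P.cocycles Y n →ₗ[R]
    ((Ext R (ModuleCat.{u} R) n).obj (Opposite.op X)).obj Y where
  toFun z := (P.isoExt n Y).inv.hom (homologyClass ((P.complex.linearYonedaObj R Y).sc n)
    ⟨z.1, (cocycles_eq_ker P Y n).le z.2⟩)
  map_add' z w := by
    refine Eq.trans ?_ (map_add _ _ _)
    refine congrArg (P.isoExt n Y).inv.hom ?_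
    exact map_add (homologyClass ((P.complex.linearYonedaObj R Y).sc n)) 
      ⟨z.1, (cocycles_eq_ker P Y n).le z.2⟩ ⟨w.1, (cocycles_eq_ker P Y n).le w.2⟩
  map_smul' r z := by
    refine Eq.trans ?_ (map_smul _ _ _)
    refine congrArg (P.isoExt n Y).inv.hom ?_
    exact map_smul (homologyClass ((P.complex.linearYonedaObj R Y).sc n)) r
      ⟨z.1, (cocycles_eq_ker P Y n).le z.2⟩

lemma leftDerivedExtClass_surjective : Function.Surjective (leftDerivedExtClass P Y n) := by
  intro x
  obtain ⟨y, rfl⟩ := (ModuleCat.epi_iff_surjective (P.isoExt (R := R) n Y).inv).1 inferInstance x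
  obtain ⟨z, rfl⟩ := homologyClass_surjective _ y
  exact ⟨⟨z.1, (cocycles_eq_ker P Y n).ge z.2⟩, rfl⟩

lemma leftDerivedExtClass_eq_zero_iff (z : P.cocycles Y n) :
    leftDerivedExtClass P Y n z = 0 ↔
      ∃ f : P.complex.X ((ComplexShape.up ℕ).prev n) ⟶ Y, P.complex.d _ _ ≫ f = z.1 := by
  have h : Function.Injective (P.isoExt (R := R) n Y).inv.hom :=
    (ModuleCat.mono_iff_injective _).1 inferInstance
  exact (map_eq_zero_iff _ h).trans (homologyClass_eq_zero_iff _ _)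

variable {P} in
lemma map_leftDerivedExtClass {X' : ModuleCat.{u} R} {g : X' ⟶ X}
    {P' : ProjectiveResolution X'} (φ : ProjectiveResolution.Hom P' P g)
    (z : P.cocycles Y n) (w : P'.cocycles Y n) (h : φ.hom.f n ≫ z.1 = w.1) :
    (((Ext R (ModuleCat.{u} R) n).map g.op).app Y).hom (leftDerivedExtClass P Y n z) =
      leftDerivedExtClass P' Y n w := by
  refine (congr($(isoExt_inv_naturality g P P' φ Y n) (homologyClass _ 
    ⟨z.1, (cocycles_eq_ker P Y n).le z.2⟩))).trans ?_
  exact congrArg (P'.isoExt n Y).inv.hom (homologyMap_homologyClass _ _ 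
    ⟨w.1, (cocycles_eq_ker P' Y n).le w.2⟩ h)

end ExtComparison

section ExtComparison
variable {R : Type u} [CommRing R] {X : ModuleCat.{u} R} (P : ProjectiveResolution X)
  (Y : ModuleCat.{u} R) (n : ℕ)

lemma CategoryTheory.ProjectiveResolution.extMk_degree_zero_eq_zero_iff {X Y : ModuleCat.{u} R}
    (P : ProjectiveResolution X) (f : P.complex.X 0 ⟶ Y) (hf : P.complex.d 1 0 ≫ f = 0) :
    P.extMk f 1 rfl hf = 0 ↔ f = 0 := by
  constructor
  · intro h
    rw [← P.extEquivCohomologyClass.apply_eq_iff_eq, P.extEquivCohomologyClass_extMk,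
      P.extEquivCohomologyClass_zero, CochainComplex.HomComplex.CohomologyClass.mk_eq_zero_iff,
      CochainComplex.HomComplex.Cocycle.toSingleMk_mem_coboundaries_iff _ _ _ _ _ 1 (by simp)] at h
    obtain ⟨g, hg⟩ := h
    have h0 : P.cochainComplex.d (-(0 : ℕ)) 1 = 0 := by
      apply Limits.IsZero.eq_of_tgt
      exact P.cochainComplex.isZero_of_isStrictlyLE 0 1 
    rw [h0, Limits.zero_comp] at hg
    rw [← cancel_epi (P.cochainComplexXIso (-(0 : ℕ)) 0 rfl).hom]
    simpa using hg.symm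
  · rintro rfl
    exact P.extMk_zero 1 rfl

/-- The class in `Abelian.Ext` of a cocycle. -/
noncomputable def extClassOfCocycle : P.cocycles Y n →ₗ[R] Abelian.Ext X Y n where
  toFun z := P.extMk z.1 (n + 1) rfl z.2
  map_add' z w := (P.add_extMk z.1 w.1 (n + 1) rfl z.2 w.2).symm
  map_smul' r z := by
    rw [Abelian.Ext.smul_eq_comp_mk₀]
    refine Eq.trans ?_ (P.extMk_comp_mk₀ z.1 (n + 1) rfl z.2 _).symm
    have : (r • z).1 = z.1 ≫ ((RingHom.id R) r • 𝟙 Y) := by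
      change r • z.1 = z.1 ≫ (r • 𝟙 Y)
      simp
    congr 1

lemma extClassOfCocycle_surjective : Function.Surjective (extClassOfCocycle P Y n) := fun x ↦ by
  obtain ⟨f, hf, rfl⟩ := P.extMk_surjective x (n + 1) rfl
  exact ⟨⟨f, hf⟩, rfl⟩

lemma extClassOfCocycle_eq_zero_iff (z : P.cocycles Y n) :
    extClassOfCocycle P Y n z = 0 ↔ leftDerivedExtClass P Y n z = 0 := by
  rw [leftDerivedExtClass_eq_zero_iff]
  cases n with
  | zero =>
    have h : ((ComplexShape.up ℕ).prev 0) = 0 := by simp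
    refine (P.extMk_degree_zero_eq_zero_iff z.1 z.2).trans ?_
    have h0 : P.complex.d 0 ((ComplexShape.up ℕ).prev 0) = 0 := by rw [h]; simp
    rw [h0]
    constructor
    · intro h; exact ⟨0, by rw [h]; simp⟩
    · rintro ⟨f, hf⟩; rw [← hf]; simp
  | succ n =>
    have h : ((ComplexShape.up ℕ).prev (n + 1)) = n := by simp
    rw [h]
    exact P.extMk_eq_zero_iff z.1 _ rfl z.2 n rfl

/-- The `Ext` groups defined by derived functors and by the derived category agree. -/
noncomputable def extEquivOfResolution : 
    ((Ext R (ModuleCat.{u} R) n).obj (Opposite.op X)).obj Y ≃ₗ[R] Abelian.Ext X Y n :=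
  ((leftDerivedExtClass P Y n).quotKerEquivOfSurjective (leftDerivedExtClass_surjective P Y n)).symm
   ≪≫ₗ Submodule.quotEquivOfEq _ _ (by
      ext z; exact (extClassOfCocycle_eq_zero_iff P Y n z).symm) ≪≫ₗ
  ((extClassOfCocycle P Y n).quotKerEquivOfSurjective (extClassOfCocycle_surjective P Y n))

lemma extEquivOfResolution_leftDerivedExtClass (z : P.cocycles Y n) :
    extEquivOfResolution P Y n (leftDerivedExtClass P Y n z) = extClassOfCocycle P Y n z := by
  have : ((leftDerivedExtClass P Y n).quotKerEquivOfSurjective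
      (leftDerivedExtClass_surjective P Y n)).symm (leftDerivedExtClass P Y n z) =
      Submodule.Quotient.mk z := by
    rw [LinearEquiv.symm_apply_eq]; rfl
  simp only [extEquivOfResolution, LinearEquiv.trans_apply]
  rw [this]
  rfl

variable {P} in
lemma extEquivOfResolution_naturality {X' : ModuleCat.{u} R} (g : X' ⟶ X)
    (P' : ProjectiveResolution X')
    (x : ((Ext R (ModuleCat.{u} R) n).obj (Opposite.op X)).obj Y) :
    extEquivOfResolution P' Y n ((((Ext R (ModuleCat.{u} R) n).map g.op).app Y).hom x) =
      (Abelian.Ext.mk₀ g).comp (extEquivOfResolution P Y n x) (zero_add n) := by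
  obtain ⟨φ⟩ : Nonempty (ProjectiveResolution.Hom P' P g) := 
    ⟨⟨ProjectiveResolution.lift g P' P, ProjectiveResolution.lift_commutes_zero g P' P⟩⟩
  obtain ⟨z, rfl⟩ := leftDerivedExtClass_surjective P Y n x
  let w : P'.cocycles Y n := ⟨φ.hom.f n ≫ z.1, by 
    have : P.complex.d (n + 1) n ≫ z.1 = 0 := z.2
    change P'.complex.d (n + 1) n ≫ φ.hom.f n ≫ z.1 = 0
    rw [← φ.hom.comm_assoc, this, Limits.comp_zero]⟩
  refine (congrArg _ (map_leftDerivedExtClass Y n φ z w rfl)).trans ?_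
  refine (extEquivOfResolution_leftDerivedExtClass P' Y n w).trans ?_
  refine Eq.trans ?_ (congrArg (fun y ↦ (Abelian.Ext.mk₀ g).comp y (zero_add n))
    (extEquivOfResolution_leftDerivedExtClass P Y n z).symm)
  exact (ProjectiveResolution.mk₀_comp_extMk z.1 (n + 1) rfl z.2 φ).symm

end ExtComparison

section LocCoh
variable {R : Type u} [CommRing R] (a : Ideal R)

/-- The projection `R/a^l ⟶ R/a^k` for `k ≤ l`. -/
noncomputable def quotientPowMap {k l : ℕ} (h : k ≤ l) :
    ModuleCat.of R (R ⧸ a ^ l) ⟶ ModuleCat.of R (R ⧸ a ^ k) :=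
  ModuleCat.ofHom (Submodule.mapQ _ _ LinearMap.id (Ideal.pow_le_pow_right h))

lemma quotientPowMap_self (k : ℕ) : quotientPowMap a (le_refl k) = 𝟙 _ := by
  refine ModuleCat.hom_ext (LinearMap.ext fun x ↦ ?_)
  obtain ⟨r, rfl⟩ := Ideal.Quotient.mk_surjective x
  rfl

lemma quotientPowMap_comp {k l m : ℕ} (h : k ≤ l) (h' : l ≤ m) :
    quotientPowMap a h' ≫ quotientPowMap a h = quotientPowMap a (h.trans h') := by
  refine ModuleCat.hom_ext (LinearMap.ext fun x ↦ ?_)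
  obtain ⟨r, rfl⟩ := Ideal.Quotient.mk_surjective x
  rfl

/-- The transition map `Ext^i(R/a^k, M) → Ext^i(R/a^l, M)`. -/
noncomputable def extPowMap (i : ℕ) (M : ModuleCat.{u} R) (k l : ℕ) (h : k ≤ l) :
    Abelian.Ext (ModuleCat.of R (R ⧸ a ^ k)) M i →ₗ[R]
      Abelian.Ext (ModuleCat.of R (R ⧸ a ^ l)) M i :=
  Abelian.Ext.precompOfLinear (Abelian.Ext.mk₀ (quotientPowMap a h)) R M (zero_add i)

lemma extPowMap_apply (i : ℕ) (M : ModuleCat.{u} R) (k l : ℕ) (h : k ≤ l)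
    (x : Abelian.Ext (ModuleCat.of R (R ⧸ a ^ k)) M i) :
    extPowMap a i M k l h x = (Abelian.Ext.mk₀ (quotientPowMap a h)).comp x (zero_add i) := rfl

instance (i : ℕ) (M : ModuleCat.{u} R) :
    DirectedSystem (fun k ↦ Abelian.Ext (ModuleCat.of R (R ⧸ a ^ k)) M i)
      (fun k l h ↦ extPowMap a i M k l h) where
  map_self k x := by
    rw [extPowMap_apply, quotientPowMap_self, Abelian.Ext.mk₀_id_comp]
  map_map k j l h h' x := by
    simp only [extPowMap_apply]
    rw [← Abelian.Ext.comp_assoc _ _ _ (add_zero 0) (zero_add _) (by simp),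
      Abelian.Ext.mk₀_comp_mk₀, quotientPowMap_comp]

/-- Local cohomology as a direct limit of modules. -/
abbrev LocCoh (i : ℕ) (M : ModuleCat.{u} R) : Type u :=
  Module.DirectLimit (fun k ↦ Abelian.Ext (ModuleCat.of R (R ⧸ a ^ k)) M i)
    (fun k l h ↦ extPowMap a i M k l h)

/-- The canonical map `Ext^i(R/a^k, M) → H^i_a(M)`. -/
noncomputable abbrev LocCoh.of (i : ℕ) (M : ModuleCat.{u} R) (k : ℕ) :
    Abelian.Ext (ModuleCat.of R (R ⧸ a ^ k)) M i →ₗ[R] LocCoh a i M :=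
  Module.DirectLimit.of R ℕ (fun k ↦ Abelian.Ext (ModuleCat.of R (R ⧸ a ^ k)) M i)
    (fun k l h ↦ extPowMap a i M k l h) k

open Opposite in
theorem nonempty_localCohomology_equiv (i : ℕ) (M : ModuleCat.{u} R) :
    Nonempty ((localCohomology a i).obj M ≃ₗ[R] LocCoh a i M) := by
  let D := localCohomology.diagram (localCohomology.idealPowersDiagram a) i
  let G : ℕᵒᵖᵒᵖ ⥤ ModuleCat.{u} R := D ⋙ (evaluation _ _).obj M
  have : Limits.PreservesFilteredColimitsOfSize.{0, 0} (forget (ModuleCat.{u} R)) :=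
    Limits.preservesSmallestFilteredColimits_of_preservesFilteredColimits.{u, u} _
  have : IsFiltered ℕᵒᵖᵒᵖ := inferInstance
  have : Limits.PreservesColimit G (forget (ModuleCat.{u} R)) := inferInstance
  have e1 : (localCohomology a i).obj M ≅ Limits.colimit G :=
    Limits.colimitObjIsoColimitCompEvaluation D M
  let P (k : ℕ) := projectiveResolution (ModuleCat.of R (R ⧸ a ^ k))
  let e (k : ℕ) : G.obj (op (op k)) ≃ₗ[R] Abelian.Ext (ModuleCat.of R (R ⧸ a ^ k)) M i :=
    extEquivOfResolution (P k) M i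
  have he (k l : ℕ) (h : k ≤ l) (x) : e l ((G.map (homOfLE h).op.op).hom x) =
      extPowMap a i M k l h (e k x) :=
    extEquivOfResolution_naturality M i (quotientPowMap a h) (P l) x
  have he' (k l : ℕ) (h : k ≤ l) (x) : (G.map (homOfLE h).op.op).hom ((e k).symm x) =
      (e l).symm (extPowMap a i M k l h x) := by
    rw [LinearEquiv.eq_symm_apply, he, LinearEquiv.apply_symm_apply]
  let φ : LocCoh a i M →ₗ[R] (Limits.colimit G : ModuleCat.{u} R) :=
    Module.DirectLimit.lift _ _ _ _
      (fun k ↦ (Limits.colimit.ι G (op (op k))).hom ∘ₗ (e k).symm.toLinearMap) (by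
        intro k l h x
        simp only [LinearMap.comp_apply, LinearEquiv.coe_coe]
        rw [← he']
        exact congr($(Limits.colimit.w G (homOfLE h).op.op) ((e k).symm x)))
  have hφ (k x) : φ (LocCoh.of a i M k x) = Limits.colimit.ι G (op (op k)) ((e k).symm x) :=
    Module.DirectLimit.lift_of _ _ _
  refine ⟨e1.toLinearEquiv ≪≫ₗ (LinearEquiv.ofBijective φ ⟨?_, ?_⟩).symm⟩
  · rw [injective_iff_map_eq_zero]
    intro z hz
    obtain ⟨k, x, rfl⟩ := Module.DirectLimit.exists_of z
    rw [hφ] at hz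
    obtain ⟨l, f, g, h⟩ := (Limits.Concrete.colimit_rep_eq_iff_exists G ((e k).symm x)
      (0 : G.obj (op (op k)))).1 (hz.trans (map_zero (Limits.colimit.ι G (op (op k))).hom).symm)
    obtain ⟨⟨l⟩⟩ := l
    have hkl : k ≤ l := leOfHom f.unop.unop
    have hf : f = (homOfLE hkl).op.op := Subsingleton.elim _ _
    have h1 : (G.map (homOfLE hkl).op.op).hom ((e k).symm x) = 0 := by
      rw [← hf]; exact h.trans (map_zero (G.map g).hom)
    rw [he', LinearEquiv.map_eq_zero_iff] at h1
    rw [← Module.DirectLimit.of_f (hij := hkl)]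
    exact (congrArg _ h1).trans (map_zero _)
  · intro y
    obtain ⟨⟨⟨k⟩⟩, x, rfl⟩ := Limits.Concrete.colimit_exists_rep G y
    refine ⟨LocCoh.of a i M k (e k x), (hφ k _).trans ?_⟩
    exact congrArg (Limits.colimit.ι G (op (op k))) ((e k).symm_apply_apply x)

end LocCoh

section DirectLimitExact
variable {R ι : Type*} [CommRing R] [Preorder ι] [DecidableEq ι] [IsDirectedOrder ι] [Nonempty ι]
  {A B C : ι → Type*} [∀ i, AddCommGroup (A i)] [∀ i, Module R (A i)]
  [∀ i, AddCommGroup (B i)] [∀ i, Module R (B i)] [∀ i, AddCommGroup (C i)] [∀ i, Module R (C i)]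
  {α : ∀ i j, i ≤ j → A i →ₗ[R] A j} {β : ∀ i j, i ≤ j → B i →ₗ[R] B j}
  {γ : ∀ i j, i ≤ j → C i →ₗ[R] C j} [DirectedSystem C fun i j h ↦ γ i j h]

lemma Module.DirectLimit.exact_map (f : ∀ i, A i →ₗ[R] B i)
    (hf : ∀ i j h, f j ∘ₗ α i j h = β i j h ∘ₗ f i) (g : ∀ i, B i →ₗ[R] C i)
    (hg : ∀ i j h, g j ∘ₗ β i j h = γ i j h ∘ₗ g i)
    (hfg : ∀ i, Function.Exact (f i) (g i)) :
    Function.Exact (Module.DirectLimit.map f hf) (Module.DirectLimit.map g hg) := by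
  intro y
  constructor
  · intro hy
    obtain ⟨i, y, rfl⟩ := Module.DirectLimit.exists_of y
    rw [Module.DirectLimit.map_apply_of] at hy
    obtain ⟨j, h, hj⟩ := Module.DirectLimit.of.zero_exact hy
    have h1 : g j (β i j h y) = 0 := (congr($(hg i j h) y)).trans hj
    obtain ⟨x, hx⟩ := (hfg j _).1 h1
    refine ⟨Module.DirectLimit.of R ι A α j x, ?_⟩
    rw [Module.DirectLimit.map_apply_of, hx, Module.DirectLimit.of_f]
  · rintro ⟨x, rfl⟩
    obtain ⟨i, x, rfl⟩ := Module.DirectLimit.exists_of x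
    rw [Module.DirectLimit.map_apply_of, Module.DirectLimit.map_apply_of, (hfg i).apply_apply_eq_zero,
      map_zero]

end DirectLimitExact

section ExtLinear
variable (R : Type u) [CommRing R] (X : ModuleCat.{u} R) {S : ShortComplex (ModuleCat.{u} R)}
  (hS : S.ShortExact) (i : ℕ)
include hS

lemma exact_ext_map_map : Function.Exact
    (Abelian.Ext.postcompOfLinear (Abelian.Ext.mk₀ S.f) R X (add_zero i))
    (Abelian.Ext.postcompOfLinear (Abelian.Ext.mk₀ S.g) R X (add_zero i)) := by
  intro y
  refine ⟨fun hy ↦ Abelian.Ext.covariant_sequence_exact₂ X hS y hy, ?_⟩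
  rintro ⟨x, rfl⟩
  change (x.comp _ (add_zero i)).comp _ (add_zero i) = 0
  simp

lemma exact_ext_map_δ : Function.Exact
    (Abelian.Ext.postcompOfLinear (Abelian.Ext.mk₀ S.g) R X (add_zero i))
    (Abelian.Ext.postcompOfLinear hS.extClass R X (rfl : i + 1 = i + 1)) := by
  intro y
  refine ⟨fun hy ↦ Abelian.Ext.covariant_sequence_exact₃ X hS y rfl hy, ?_⟩
  rintro ⟨x, rfl⟩
  change (x.comp _ (add_zero i)).comp _ rfl = 0
  simp

lemma exact_ext_δ_map : Function.Exact
    (Abelian.Ext.postcompOfLinear hS.extClass R X (rfl : i + 1 = i + 1))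
    (Abelian.Ext.postcompOfLinear (Abelian.Ext.mk₀ S.f) R X (add_zero (i + 1))) := by
  intro y
  refine ⟨fun hy ↦ Abelian.Ext.covariant_sequence_exact₁ X hS y hy rfl, ?_⟩
  rintro ⟨x, rfl⟩
  change (x.comp _ rfl).comp _ (add_zero (i + 1)) = 0
  simp

end ExtLinear

namespace LocCoh
variable {R : Type u} [CommRing R] (a : Ideal R)

lemma extPowMap_postcomp {i n j : ℕ} {M N : ModuleCat.{u} R} (β : Abelian.Ext M N n)
    (h : i + n = j) (k l : ℕ) (hkl : k ≤ l) :
    Abelian.Ext.postcompOfLinear β R _ h ∘ₗ extPowMap a i M k l hkl =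
      extPowMap a j N k l hkl ∘ₗ Abelian.Ext.postcompOfLinear β R _ h := by
  ext x
  change ((Abelian.Ext.mk₀ _).comp x (zero_add i)).comp β h =
    (Abelian.Ext.mk₀ _).comp (x.comp β h) (zero_add j)
  rw [Abelian.Ext.comp_assoc _ _ _ (zero_add i) h (by lia)]

/-- The map on local cohomology given by composition with an extension class. -/
noncomputable def postcomp {i n j : ℕ} {M N : ModuleCat.{u} R} (β : Abelian.Ext M N n)
    (h : i + n = j) : LocCoh a i M →ₗ[R] LocCoh a j N :=
  Module.DirectLimit.map (fun _ ↦ Abelian.Ext.postcompOfLinear β R _ h)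
    (fun k l hkl ↦ extPowMap_postcomp a β h k l hkl)

lemma postcomp_of {i n j : ℕ} {M N : ModuleCat.{u} R} (β : Abelian.Ext M N n)
    (h : i + n = j) (k : ℕ) (x : Abelian.Ext (ModuleCat.of R (R ⧸ a ^ k)) M i) :
    postcomp a β h (of a i M k x) = of a j N k (x.comp β h) :=
  Module.DirectLimit.map_apply_of _ _ _

/-- Functoriality of local cohomology. -/
noncomputable abbrev map (i : ℕ) {M N : ModuleCat.{u} R} (f : M ⟶ N) :
    LocCoh a i M →ₗ[R] LocCoh a i N :=
  postcomp a (Abelian.Ext.mk₀ f) (add_zero i)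

section LES
variable {S : ShortComplex (ModuleCat.{u} R)} (hS : S.ShortExact) (i : ℕ)

/-- The connecting homomorphism in local cohomology. -/
noncomputable abbrev δ : LocCoh a i S.X₃ →ₗ[R] LocCoh a (i + 1) S.X₁ :=
  postcomp a hS.extClass rfl

include hS in
lemma exact_map_map : Function.Exact (map a i S.f) (map a i S.g) :=
  Module.DirectLimit.exact_map _ _ _ _ fun _ ↦ exact_ext_map_map R _ hS i

lemma exact_map_δ : Function.Exact (map a i S.g) (δ a hS i) :=
  Module.DirectLimit.exact_map _ _ _ _ fun _ ↦ exact_ext_map_δ R _ hS i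

lemma exact_δ_map : Function.Exact (δ a hS i) (map a (i + 1) S.f) :=
  Module.DirectLimit.exact_map _ _ _ _ fun _ ↦ exact_ext_δ_map R _ hS i

end LES

instance subsingleton_of_injective (i : ℕ) (I : ModuleCat.{u} R) [Injective I] :
    Subsingleton (LocCoh a (i + 1) I) := by
  refine subsingleton_of_forall_eq 0 fun z ↦ ?_
  obtain ⟨k, x, rfl⟩ := Module.DirectLimit.exists_of z
  rw [x.eq_zero_of_injective, map_zero]

lemma ext_smul_eq_zero (M : ModuleCat.{u} R) (i : ℕ) (b : Ideal R)
    (x : Abelian.Ext (ModuleCat.of R (R ⧸ b)) M i) {r : R} (hr : r ∈ b) : r • x = 0 := by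
  have h : r • 𝟙 (ModuleCat.of R (R ⧸ b)) = 0 := by
    refine ModuleCat.hom_ext (LinearMap.ext fun y ↦ ?_)
    obtain ⟨y, rfl⟩ := Ideal.Quotient.mk_surjective y
    change r • Ideal.Quotient.mk b y = 0
    rw [← Ideal.Quotient.mkₐ_eq_mk R, ← map_smul, Ideal.Quotient.mkₐ_eq_mk,
      Ideal.Quotient.eq_zero_iff_mem]
    exact b.mul_mem_right y hr
  have h1 := Abelian.Ext.smul_comp (Abelian.Ext.mk₀ (𝟙 (ModuleCat.of R (R ⧸ b)))) x (zero_add i) r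
  rw [← Abelian.Ext.mk₀_smul, h, Abelian.Ext.mk₀_zero, Abelian.Ext.zero_comp,
    Abelian.Ext.mk₀_id_comp] at h1
  exact h1.symm

lemma exists_pow_smul_eq_zero (i : ℕ) (M : ModuleCat.{u} R) (z : LocCoh a i M) :
    ∃ k, ∀ r ∈ a ^ k, r • z = 0 := by
  obtain ⟨k, x, rfl⟩ := Module.DirectLimit.exists_of z
  exact ⟨k, fun r hr ↦ by rw [← map_smul, ext_smul_eq_zero M i _ x hr, map_zero]⟩

end LocCoh

section PowTorsion
variable {R : Type*} [CommRing R] (a : Ideal R) (M : Type*) [AddCommGroup M] [Module R M]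

/-- The submodule of elements killed by a power of `a`. -/
def powTorsion : Submodule R M where
  carrier := {m | ∃ k, ∀ r ∈ a ^ k, r • m = 0}
  zero_mem' := ⟨0, fun r _ ↦ smul_zero r⟩
  add_mem' := by
    rintro x y ⟨k, hk⟩ ⟨l, hl⟩
    refine ⟨k + l, fun r hr ↦ ?_⟩
    rw [smul_add, hk r (Ideal.pow_le_pow_right (Nat.le_add_right k l) hr),
      hl r (Ideal.pow_le_pow_right (Nat.le_add_left l k) hr), add_zero]
  smul_mem' := by
    rintro c x ⟨k, hk⟩
    exact ⟨k, fun r hr ↦ by rw [smul_comm, hk r hr, smul_zero]⟩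

variable {a M} in
lemma mem_powTorsion {m : M} : m ∈ powTorsion a M ↔ ∃ k, ∀ r ∈ a ^ k, r • m = 0 := Iff.rfl

end PowTorsion

section DegreeZero
variable {R : Type u} [CommRing R] (b : Ideal R)

/-- Evaluation at `1`. -/
noncomputable def extZeroEval (M : ModuleCat.{u} R) :
    Abelian.Ext (ModuleCat.of R (R ⧸ b)) M 0 →ₗ[R] M where
  toFun x := (Abelian.Ext.linearEquiv₀ (R := R) x).hom (Ideal.Quotient.mk b 1)
  map_add' x y := by rw [map_add]; rfl
  map_smul' r x := by rw [map_smul]; rfl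

lemma extZeroEval_mk₀ {M : ModuleCat.{u} R} (g : ModuleCat.of R (R ⧸ b) ⟶ M) :
    extZeroEval b M (Abelian.Ext.mk₀ g) = g.hom (Ideal.Quotient.mk b 1) := by
  change (Abelian.Ext.linearEquiv₀ (R := R) (Abelian.Ext.linearEquiv₀ (R := R).symm g)).hom _ = _
  rw [LinearEquiv.apply_symm_apply]

lemma extZeroEval_injective (M : ModuleCat.{u} R) : Function.Injective (extZeroEval b M) := by
  rw [injective_iff_map_eq_zero]
  intro x hx
  obtain ⟨g, rfl⟩ := (Abelian.Ext.linearEquiv₀ (R := R)).symm.surjective x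
  have hx' : g.hom (Ideal.Quotient.mk b 1) = 0 := (extZeroEval_mk₀ b g).symm.trans hx
  have : g = 0 := by
    refine ModuleCat.hom_ext (LinearMap.ext fun y ↦ ?_)
    obtain ⟨y, rfl⟩ := Ideal.Quotient.mk_surjective y
    have h : Ideal.Quotient.mk b y = y • Ideal.Quotient.mk b 1 := by
      rw [← Ideal.Quotient.mkₐ_eq_mk R, ← map_smul]; simp
    rw [h]
    exact (map_smul g.hom _ _).trans (by rw [hx', smul_zero]; rfl)
  rw [this, map_zero]

lemma mem_range_extZeroEval (M : ModuleCat.{u} R) (m : M) :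
    m ∈ LinearMap.range (extZeroEval b M) ↔ ∀ r ∈ b, r • m = 0 := by
  constructor
  · rintro ⟨x, rfl⟩ r hr
    rw [← map_smul, LocCoh.ext_smul_eq_zero M 0 b x hr, map_zero]
  · intro h
    let g : ModuleCat.of R (R ⧸ b) ⟶ M := ModuleCat.ofHom
      (Submodule.liftQ b (LinearMap.toSpanSingleton R M m) fun r hr ↦ by
        exact h r hr)
    refine ⟨Abelian.Ext.mk₀ g, (extZeroEval_mk₀ b g).trans ?_⟩
    change (LinearMap.toSpanSingleton R M m) 1 = m
    exact one_smul R m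

lemma extZeroEval_comp_mk₀ {M N : ModuleCat.{u} R} (f : M ⟶ N)
    (x : Abelian.Ext (ModuleCat.of R (R ⧸ b)) M 0) :
    extZeroEval b N (x.comp (Abelian.Ext.mk₀ f) (add_zero 0)) = f.hom (extZeroEval b M x) := by
  obtain ⟨g, rfl⟩ := (Abelian.Ext.linearEquiv₀ (R := R)).symm.surjective x
  change extZeroEval b N ((Abelian.Ext.mk₀ g).comp (Abelian.Ext.mk₀ f) (add_zero 0)) =
    f.hom (extZeroEval b M (Abelian.Ext.mk₀ g))
  rw [Abelian.Ext.mk₀_comp_mk₀, extZeroEval_mk₀, extZeroEval_mk₀]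
  rfl

namespace LocCoh
variable (a : Ideal R)

lemma extZeroEval_extPowMap (M : ModuleCat.{u} R) (k l : ℕ) (h : k ≤ l)
    (x : Abelian.Ext (ModuleCat.of R (R ⧸ a ^ k)) M 0) :
    extZeroEval (a ^ l) M (extPowMap a 0 M k l h x) = extZeroEval (a ^ k) M x := by
  obtain ⟨g, rfl⟩ := (Abelian.Ext.linearEquiv₀ (R := R)).symm.surjective x
  change extZeroEval (a ^ l) M ((Abelian.Ext.mk₀ (quotientPowMap a h)).comp (Abelian.Ext.mk₀ g)
    (zero_add 0)) = extZeroEval (a ^ k) M (Abelian.Ext.mk₀ g)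
  rw [Abelian.Ext.mk₀_comp_mk₀, extZeroEval_mk₀, extZeroEval_mk₀]
  rfl

/-- The embedding of `H^i_a(M)` for `i = 0` into `M`. -/
noncomputable def zeroEval (M : ModuleCat.{u} R) : LocCoh a 0 M →ₗ[R] M :=
  Module.DirectLimit.lift R ℕ _ _ (fun k ↦ extZeroEval (a ^ k) M)
    (fun k l h x ↦ extZeroEval_extPowMap a M k l h x)

lemma zeroEval_of (M : ModuleCat.{u} R) (k : ℕ)
    (x : Abelian.Ext (ModuleCat.of R (R ⧸ a ^ k)) M 0) :
    zeroEval a M (of a 0 M k x) = extZeroEval (a ^ k) M x :=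
  Module.DirectLimit.lift_of _ _ _

lemma zeroEval_injective (M : ModuleCat.{u} R) : Function.Injective (zeroEval a M) :=
  Module.DirectLimit.lift_injective _ _ fun _ ↦ extZeroEval_injective _ M

lemma range_zeroEval (M : ModuleCat.{u} R) :
    LinearMap.range (zeroEval a M) = powTorsion a M := by
  ext m
  constructor
  · rintro ⟨z, rfl⟩
    obtain ⟨k, h⟩ := exists_pow_smul_eq_zero a 0 M z
    exact ⟨k, fun r hr ↦ by rw [← map_smul, h r hr, map_zero]⟩
  · rintro ⟨k, h⟩
    obtain ⟨x, rfl⟩ := (mem_range_extZeroEval (a ^ k) M m).2 h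
    exact ⟨of a 0 M k x, zeroEval_of a M k x⟩

lemma zeroEval_map {M N : ModuleCat.{u} R} (f : M ⟶ N) (z : LocCoh a 0 M) :
    zeroEval a N (map a 0 f z) = f.hom (zeroEval a M z) := by
  obtain ⟨k, x, rfl⟩ := Module.DirectLimit.exists_of z
  refine (congrArg _ (postcomp_of a _ _ k x)).trans ?_
  rw [zeroEval_of]
  exact (extZeroEval_comp_mk₀ _ f x).trans (congrArg _ (zeroEval_of a M k x).symm)

/-- `H^i_a(M)` for `i = 0` is the submodule of elements killed by a power of `a`. -/
noncomputable def zeroEquiv (M : ModuleCat.{u} R) : LocCoh a 0 M ≃ₗ[R] powTorsion a M :=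
  LinearEquiv.ofInjective _ (zeroEval_injective a M) ≪≫ₗ LinearEquiv.ofEq _ _ (range_zeroEval a M)

end LocCoh
end DegreeZero

section PowTorsionInjective
variable {R : Type u} [CommRing R] (a : Ideal R)

lemma Submodule.FG.exists_pow_smul_eq_zero {N : Type*} [AddCommGroup N] [Module R N]
    {P : Submodule R N} (hP : P.FG) (h : P ≤ powTorsion a N) :
    ∃ k, ∀ r ∈ a ^ k, ∀ x ∈ P, r • x = 0 := by
  obtain ⟨s, rfl⟩ := hP
  have hs : ∀ x : s, ∃ k, ∀ r ∈ a ^ k, r • (x : N) = 0 := fun x ↦ h (subset_span x.2)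
  choose k hk using hs
  refine ⟨s.attach.sup k, fun r hr x hx ↦ ?_⟩
  induction hx using Submodule.span_induction with
  | mem x hx =>
    exact hk ⟨x, hx⟩ r (Ideal.pow_le_pow_right (Finset.le_sup (Finset.mem_attach s ⟨x, hx⟩)) hr)
  | zero => exact smul_zero r
  | add x y _ _ hx hy => rw [smul_add, hx, hy, add_zero]
  | smul c x _ hx => rw [smul_comm, hx, smul_zero]

lemma powTorsion_baer [IsNoetherianRing R] (I : Type u) [AddCommGroup I] [Module R I]
    [Module.Injective R I] : Module.Baer R (powTorsion a I) := by
  intro J f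
  have hfg : ((⊤ : Submodule R J).map f).FG := (IsNoetherian.noetherian ⊤).map f
  obtain ⟨k, hk⟩ := hfg.exists_pow_smul_eq_zero a (N := powTorsion a I) (by
    rintro ⟨x, k, hk⟩ -
    exact ⟨k, fun r hr ↦ Subtype.ext (hk r hr)⟩)
  obtain ⟨c, hc⟩ := Ideal.exists_pow_inf_eq_pow_smul a (J : Submodule R R)
  have hn := hc (k + c) (Nat.le_add_left c k)
  rw [Nat.add_sub_cancel] at hn
  have hker : ∀ x : J, (x : R) ∈ a ^ (k + c) → f x = 0 := by
    rintro ⟨x, hxJ⟩ hx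
    have hx' : x ∈ a ^ k • (a ^ c • ⊤ ⊓ J : Submodule R R) := by
      rw [← hn]
      exact ⟨by simpa using hx, hxJ⟩
    have hx'' : x ∈ a ^ k • (J : Submodule R R) := Submodule.smul_mono le_rfl inf_le_right hx'
    have key : ∀ y ∈ a ^ k • (J : Submodule R R), ∀ hy : y ∈ J, f ⟨y, hy⟩ = 0 := by
      intro y hy
      induction hy using Submodule.smul_induction_on' with
      | smul r hr n hn =>
        intro hy
        have : (⟨r • n, hy⟩ : J) = r • ⟨n, hn⟩ := rfl
        rw [this, map_smul]
        exact hk r hr _ ⟨_, trivial, rfl⟩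
      | add x hx y hy hx' hy' =>
        intro hxy
        have hxJ := (Submodule.smul_le_right : a ^ k • (J : Submodule R R) ≤ J) hx
        have hyJ := (Submodule.smul_le_right : a ^ k • (J : Submodule R R) ≤ J) hy
        have : (⟨x + y, hxy⟩ : J) = ⟨x, hxJ⟩ + ⟨y, hyJ⟩ := rfl
        rw [this, map_add, hx' hxJ, hy' hyJ, add_zero]
    exact key x hx'' hxJ
  let j : J →ₗ[R] R := Submodule.subtype (J : Submodule R R)
  let B : Submodule R R := a ^ (k + c)
  let K : Submodule R J := LinearMap.ker (B.mkQ ∘ₗ j)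
  let ι : (J ⧸ K) →ₗ[R] R ⧸ B := K.liftQ (B.mkQ ∘ₗ j) le_rfl
  have hι : Function.Injective ι := LinearMap.ker_eq_bot.mp (Submodule.ker_liftQ_eq_bot _ _ _ le_rfl)
  obtain ⟨g, hg⟩ := Module.Injective.out ι hι
    (K.liftQ ((powTorsion a I).subtype ∘ₗ f) (fun x hx ↦ by
      have hx' : (x : R) ∈ B := (Submodule.Quotient.mk_eq_zero B).mp hx
      simpa using hker x hx'))
  refine ⟨(g ∘ₗ B.mkQ).codRestrict _ fun x ↦ ⟨k + c, fun r hr ↦ ?_⟩, fun x hx ↦ Subtype.ext ?_⟩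
  · change r • g (B.mkQ x) = 0
    rw [← map_smul, ← map_smul, show B.mkQ (r • x) = 0 from
      (Submodule.Quotient.mk_eq_zero B).mpr (Ideal.mul_mem_right x _ hr), map_zero]
  · exact hg (K.mkQ ⟨x, hx⟩)

lemma Module.Injective.powTorsion [IsNoetherianRing R] (I : Type u) [AddCommGroup I] [Module R I]
    [Module.Injective R I] : Module.Injective R (powTorsion a I) :=
  (powTorsion_baer a I).injective

end PowTorsionInjective

section Embeddings
variable {R : Type u} [CommRing R]

lemma exists_injective_embedding (M : Type u) [AddCommGroup M] [Module R M] :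
    ∃ (I : ModuleCat.{u} R) (f : M →ₗ[R] I), Module.Injective R I ∧ Function.Injective f := by
  obtain ⟨J⟩ := EnoughInjectives.presentation (ModuleCat.of R M)
  exact ⟨J.J, J.f.hom, (Module.injective_iff_injective_object R J.J).mpr J.injective,
    (ModuleCat.mono_iff_injective J.f).mp inferInstance⟩

variable (a : Ideal R) [IsNoetherianRing R]

lemma exists_torsion_injective_embedding {M : Type u} [AddCommGroup M] [Module R M]
    (hM : powTorsion a M = ⊤) :
    ∃ (I : ModuleCat.{u} R) (f : M →ₗ[R] I), Module.Injective R I ∧ Function.Injective f ∧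
      powTorsion a I = ⊤ := by
  obtain ⟨I, f, hI, hf⟩ := exists_injective_embedding (R := R) M
  refine ⟨.of R (powTorsion a I), f.codRestrict _ fun x ↦ ?_, Module.Injective.powTorsion a I,
    fun x y h ↦ hf (congrArg Subtype.val h), ?_⟩
  · obtain ⟨k, hk⟩ := hM.ge (Submodule.mem_top (x := x))
    exact ⟨k, fun r hr ↦ by rw [← map_smul, hk r hr, map_zero]⟩
  · rw [eq_top_iff]
    rintro ⟨x, k, hk⟩ -
    exact ⟨k, fun r hr ↦ Subtype.ext (hk r hr)⟩

lemma exists_torsionFree_injective_embedding {M : Type u} [AddCommGroup M] [Module R M]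
    (hM : powTorsion a M = ⊥) :
    ∃ (I : ModuleCat.{u} R) (f : M →ₗ[R] I), Module.Injective R I ∧ Function.Injective f ∧
      powTorsion a I = ⊥ := by
  obtain ⟨I, f, hI, hf⟩ := exists_injective_embedding (R := R) M
  have := Module.Injective.powTorsion a I
  obtain ⟨r, hr⟩ := Module.Injective.out (powTorsion a I).subtype Subtype.val_injective
    (LinearMap.id : powTorsion a I →ₗ[R] powTorsion a I)
  let q : I →ₗ[R] LinearMap.ker r := (LinearMap.id - (powTorsion a I).subtype ∘ₗ r).codRestrict _
    fun x ↦ by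
      have := hr (r x)
      simp only [Submodule.subtype_apply, LinearMap.id_apply] at this
      simp [this]
  have hq (x : LinearMap.ker r) : q x = x := Subtype.ext (by
    have h : r x = 0 := x.2
    change (x : I) - (r x : I) = x
    rw [h, Submodule.coe_zero, sub_zero])
  refine ⟨.of R (LinearMap.ker r), q ∘ₗ f, ⟨fun X Y _ _ _ _ i hi g ↦ ?_⟩, ?_, ?_⟩
  · obtain ⟨h, hh⟩ := Module.Injective.out i hi ((LinearMap.ker r).subtype ∘ₗ g)
    exact ⟨q ∘ₗ h, fun x ↦ by
      rw [LinearMap.comp_apply, hh]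
      exact hq _⟩
  · rw [injective_iff_map_eq_zero]
    intro x hx
    have h1 : f x - (r (f x) : I) = 0 := congrArg Subtype.val hx
    have h2 : x ∈ powTorsion a M := by
      obtain ⟨k, hk⟩ := (r (f x)).2
      refine ⟨k, fun s hs ↦ hf ?_⟩
      rw [map_smul, sub_eq_zero.mp h1, map_zero]
      exact hk s hs
    rwa [hM] at h2
  · rw [eq_bot_iff]
    rintro ⟨x, hx⟩ ⟨k, hk⟩
    have h2 : x ∈ powTorsion a I := ⟨k, fun s hs ↦ congrArg Subtype.val (hk s hs)⟩
    have h3 := hr ⟨x, h2⟩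
    have h4 : r x = 0 := hx
    have h5 : (⟨x, h2⟩ : powTorsion a I) = 0 := h3.symm.trans h4
    have h6 : x = 0 := congrArg Subtype.val h5
    exact Subtype.ext h6

end Embeddings

namespace LocCoh
variable {R : Type u} [CommRing R] [IsNoetherianRing R] (a : Ideal R)

/-- The short exact sequence `0 → M → I → I / M → 0` attached to an injective map. -/
noncomputable abbrev _root_.LinearMap.shortComplexCoker {M : Type u} [AddCommGroup M] [Module R M]
    {I : Type u} [AddCommGroup I] [Module R I] (f : M →ₗ[R] I) : ShortComplex (ModuleCat.{u} R) where
  X₁ := .of R M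
  X₂ := .of R I
  X₃ := .of R (I ⧸ LinearMap.range f)
  f := ModuleCat.ofHom f
  g := ModuleCat.ofHom (LinearMap.range f).mkQ
  zero := ModuleCat.hom_ext (LinearMap.range_mkQ_comp f)

omit [IsNoetherianRing R] in
lemma _root_.LinearMap.shortExact_shortComplexCoker {M : Type u} [AddCommGroup M] [Module R M]
    {I : Type u} [AddCommGroup I] [Module R I] {f : M →ₗ[R] I} (hf : Function.Injective f) :
    f.shortComplexCoker.ShortExact :=
  ModuleCat.shortComplex_shortExact _ (LinearMap.exact_map_mkQ_range f) hf
    (Submodule.mkQ_surjective _)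

lemma subsingleton_of_torsion (i : ℕ) : ∀ (M : ModuleCat.{u} R) (_ : powTorsion a M = ⊤),
    Subsingleton (LocCoh a (i + 1) M) := by
  induction i with
  | zero =>
    intro M hM
    obtain ⟨I, f, hI, hf, hT⟩ := exists_torsion_injective_embedding a hM
    have := (Module.injective_iff_injective_object R I).mp hI
    have hS := LinearMap.shortExact_shortComplexCoker hf
    have hsurj : Function.Surjective (map a 0 f.shortComplexCoker.g) := by
      intro z
      obtain ⟨y, hy⟩ := Submodule.mkQ_surjective _ (zeroEval a _ z)
      obtain ⟨w, rfl⟩ : y ∈ LinearMap.range (zeroEval a I) := by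
        rw [range_zeroEval, hT]; trivial
      exact ⟨w, zeroEval_injective a _ ((zeroEval_map a _ w).trans hy)⟩
    refine subsingleton_of_forall_eq 0 fun x ↦ ?_
    obtain ⟨y, rfl⟩ := (exact_δ_map a hS 0 x).mp (Subsingleton.elim (α := LocCoh a 1 I) _ _)
    obtain ⟨w, rfl⟩ := hsurj y
    exact (exact_map_δ a hS 0 _).mpr ⟨w, rfl⟩
  | succ i ih =>
    intro M hM
    obtain ⟨I, f, hI, hf, hT⟩ := exists_torsion_injective_embedding a hM
    have := (Module.injective_iff_injective_object R I).mp hI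
    have hS := LinearMap.shortExact_shortComplexCoker hf
    have := ih (.of R (I ⧸ LinearMap.range f)) (by
      rw [eq_top_iff]
      rintro x -
      obtain ⟨y, rfl⟩ := Submodule.mkQ_surjective _ x
      obtain ⟨k, hk⟩ := hT.ge (Submodule.mem_top (x := y))
      exact ⟨k, fun r hr ↦ by rw [← map_smul, hk r hr, map_zero]⟩)
    refine subsingleton_of_forall_eq 0 fun x ↦ ?_
    obtain ⟨y, rfl⟩ := (exact_δ_map a hS (i + 1) x).mp
      (Subsingleton.elim (α := LocCoh a (i + 2) I) _ _)
    rw [Subsingleton.elim (α := LocCoh a (i + 1) (.of R (I ⧸ LinearMap.range f))) y 0, map_zero]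

end LocCoh

section FiniteTorsion
variable {R : Type u} [CommRing R]

lemma powTorsion_quotient_eq_bot [IsNoetherianRing R] (a : Ideal R) (M : Type*) [AddCommGroup M]
    [Module R M] : powTorsion a (M ⧸ powTorsion a M) = ⊥ := by
  rw [eq_bot_iff]
  rintro x ⟨k, hk⟩
  obtain ⟨m, rfl⟩ := Submodule.mkQ_surjective _ x
  have hfg : (Submodule.map (LinearMap.toSpanSingleton R M m) (a ^ k)).FG :=
    (IsNoetherian.noetherian (a ^ k)).map _
  obtain ⟨l, hl⟩ := hfg.exists_pow_smul_eq_zero a (by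
    rintro _ ⟨r, hr, rfl⟩
    have := hk r hr
    rwa [← map_smul, Submodule.mkQ_apply, Submodule.Quotient.mk_eq_zero] at this)
  refine (Submodule.Quotient.mk_eq_zero _).mpr ⟨l + k, fun r hr ↦ ?_⟩
  rw [pow_add] at hr
  induction hr using Submodule.mul_induction_on' with
  | mem_mul_mem s hs t ht =>
    rw [mul_smul]
    exact hl s hs _ ⟨t, ht, rfl⟩
  | add x _ y _ hx hy => rw [add_smul, hx, hy, add_zero]

lemma powTorsion_powTorsion (a : Ideal R) (M : Type*) [AddCommGroup M]
    [Module R M] : powTorsion a (powTorsion a M) = ⊤ := by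
  rw [eq_top_iff]
  rintro ⟨x, k, hk⟩ -
  exact ⟨k, fun r hr ↦ Subtype.ext (hk r hr)⟩

lemma Module.Finite.of_functionExact [IsNoetherianRing R] {A B C : Type*} [AddCommGroup A]
    [AddCommGroup B] [AddCommGroup C] [Module R A] [Module R B] [Module R C] [Module.Finite R A]
    [Module.Finite R C] {f : A →ₗ[R] B} {g : B →ₗ[R] C} (h : Function.Exact f g) :
    Module.Finite R B := by
  have := isNoetherian_of_range_eq_ker f g (LinearMap.exact_iff.mp h).symm
  infer_instance

lemma finite_torsionBySet_of_injective [IsNoetherianRing R] {A B : Type*} [AddCommGroup A]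
    [AddCommGroup B] [Module R A] [Module R B] (s : Set R) (f : A →ₗ[R] B)
    (hf : Function.Injective f) [Module.Finite R (Submodule.torsionBySet R B s)] :
    Module.Finite R (Submodule.torsionBySet R A s) := by
  refine Module.Finite.of_injective
    (f.restrict (p := Submodule.torsionBySet R A s) (q := Submodule.torsionBySet R B s)
      fun x hx ↦ ?_) fun x y h ↦ Subtype.ext (hf (congrArg Subtype.val h))
  rw [Submodule.mem_torsionBySet_iff] at hx ⊢
  intro r
  rw [← map_smul, hx, map_zero]

end FiniteTorsion

namespace LocCoh
variable {R : Type u} [CommRing R] [IsNoetherianRing R] (a : Ideal R)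

omit [IsNoetherianRing R] in
lemma nonempty_equiv_of_subsingleton {S : ShortComplex (ModuleCat.{u} R)} (hS : S.ShortExact)
    (i : ℕ) (_ : Subsingleton (LocCoh a i S.X₂)) (_ : Subsingleton (LocCoh a (i + 1) S.X₂)) :
    Nonempty (LocCoh a i S.X₃ ≃ₗ[R] LocCoh a (i + 1) S.X₁) := by
  refine ⟨LinearEquiv.ofBijective (δ a hS i) ⟨?_, fun x ↦
    (exact_δ_map a hS i x).mp (Subsingleton.elim _ _)⟩⟩
  rw [injective_iff_map_eq_zero]
  intro x hx
  obtain ⟨y, rfl⟩ := (exact_map_δ a hS i x).mp hx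
  rw [Subsingleton.elim y 0, map_zero]

set_option maxHeartbeats 1000000 in
/-- If `H^i_a(M)` is finite for `i < s` and all `Ext^j(R ⧸ a ^ k, M)` are finite, then
`Hom(R ⧸ a ^ k, H^s_a(M))` is finite. -/
theorem finite_torsionBySet (k : ℕ) (s : ℕ) : ∀ (M : ModuleCat.{u} R)
    (_ : ∀ j, Module.Finite R (Abelian.Ext (ModuleCat.of R (R ⧸ a ^ k)) M j))
    (_ : ∀ i < s, Module.Finite R (LocCoh a i M)),
    Module.Finite R (Submodule.torsionBySet R (LocCoh a s M) (a ^ k : Ideal R)) := by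
  induction s with
  | zero =>
    intro M hE _
    have := hE 0
    let f : Submodule.torsionBySet R (LocCoh a 0 M) (a ^ k : Ideal R) →ₗ[R]
        LinearMap.range (extZeroEval (a ^ k) M) :=
      (zeroEval a M).restrict fun x hx ↦ by
        rw [Submodule.mem_torsionBySet_iff] at hx
        rw [mem_range_extZeroEval]
        intro r hr
        rw [← map_smul, hx ⟨r, hr⟩, map_zero]
    exact Module.Finite.of_injective f
      fun x y h ↦ Subtype.ext (zeroEval_injective a M (congrArg Subtype.val h))
  | succ s ih =>
    intro M hE hH
    let N := powTorsion a M
    have hS := LinearMap.shortExact_shortComplexCoker N.subtype_injective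
    have hN : LinearMap.range N.subtype = N := N.range_subtype
    let Q := M ⧸ LinearMap.range N.subtype
    have : Module.Finite R N :=
      have := hH 0 s.succ_pos
      Module.Finite.equiv (zeroEquiv a M)
    have hQE (j) : Module.Finite R (Abelian.Ext (ModuleCat.of R (R ⧸ a ^ k)) (.of R Q) j) :=
      have := hE j
      have : Module.Finite R (Abelian.Ext (ModuleCat.of R (R ⧸ a ^ k)) (.of R N) (j + 1)) :=
        inferInstance
      Module.Finite.of_functionExact (exact_ext_map_δ R (.of R (R ⧸ a ^ k)) hS j)
    have hNH (i) : Subsingleton (LocCoh a (i + 1) (.of R N)) :=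
      subsingleton_of_torsion a i (.of R N) (powTorsion_powTorsion a M)
    have hQH (i) (hi : i < s) : Module.Finite R (LocCoh a (i + 1) (.of R Q)) :=
      have := hH (i + 1) (Nat.succ_lt_succ hi)
      have : Module.Finite R (LocCoh a (i + 1 + 1) (.of R N)) := inferInstance
      Module.Finite.of_functionExact (exact_map_δ a hS (i + 1))
    have hQ : powTorsion a Q = ⊥ := by
      have := powTorsion_quotient_eq_bot a M
      change powTorsion a (M ⧸ LinearMap.range N.subtype) = ⊥
      rw [hN]
      exact this
    obtain ⟨E, f, hEi, hf, hEt⟩ := exists_torsionFree_injective_embedding a hQ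
    have hEi' : Injective E := (Module.injective_iff_injective_object R E).mp hEi
    have hT := LinearMap.shortExact_shortComplexCoker hf
    let P := E ⧸ LinearMap.range f
    have hEE (j) : Subsingleton (Abelian.Ext (ModuleCat.of R (R ⧸ a ^ k)) E j) := by
      cases j with
      | zero =>
        refine subsingleton_of_forall_eq 0 fun x ↦ extZeroEval_injective (a ^ k) E ?_
        have : extZeroEval (a ^ k) E x ∈ powTorsion a E :=
          ⟨k, (mem_range_extZeroEval (a ^ k) E _).mp ⟨x, rfl⟩⟩
        rw [hEt] at this
        exact this.trans (map_zero _).symm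
      | succ j => exact subsingleton_of_forall_eq 0 fun x ↦ x.eq_zero_of_injective
    have hEH (i) : Subsingleton (LocCoh a i E) := by
      cases i with
      | zero =>
        refine subsingleton_of_forall_eq 0 fun x ↦ zeroEval_injective a E ?_
        have : zeroEval a E x ∈ powTorsion a E := by
          rw [← range_zeroEval]
          exact ⟨x, rfl⟩
        rw [hEt] at this
        exact this.trans (map_zero _).symm
      | succ i => infer_instance
    have hPE (j) : Module.Finite R (Abelian.Ext (ModuleCat.of R (R ⧸ a ^ k)) (.of R P) j) :=
      have := hQE (j + 1)
      have : Module.Finite R (Abelian.Ext (ModuleCat.of R (R ⧸ a ^ k)) E j) := inferInstance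
      Module.Finite.of_functionExact (exact_ext_map_δ R (.of R (R ⧸ a ^ k)) hT j)
    have hPH (i) (hi : i < s) : Module.Finite R (LocCoh a i (.of R P)) :=
      have := hQH i hi
      have : Module.Finite R (LocCoh a i E) := inferInstance
      Module.Finite.of_functionExact (exact_map_δ a hT i)
    have hP := ih (.of R P) hPE hPH
    have hmap : Function.Injective (map a (s + 1) N.subtype.shortComplexCoker.g) := by
      rw [injective_iff_map_eq_zero]
      intro x hx
      obtain ⟨y, rfl⟩ := (exact_map_map a hS (s + 1) x).mp hx
      rw [Subsingleton.elim (α := LocCoh a (s + 1) (.of R N)) y 0, map_zero]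
    have ⟨e⟩ := nonempty_equiv_of_subsingleton a hT s (hEH s) (hEH (s + 1))
    exact finite_torsionBySet_of_injective _ (e.symm.toLinearMap ∘ₗ
      map a (s + 1) N.subtype.shortComplexCoker.g) (e.symm.injective.comp hmap)

end LocCoh

section Localization
variable {R : Type u} [CommRing R] (a : Ideal R) (S : Submonoid R)

lemma LocalizedModule.mk_eq_zero_iff {M : Type*} [AddCommGroup M] [Module R M] {m : M} {s : S} :
    LocalizedModule.mk m s = 0 ↔ ∃ u : S, u • m = 0 := by
  rw [← LocalizedModule.zero_mk s, LocalizedModule.mk_eq]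
  constructor
  · rintro ⟨u, hu⟩
    exact ⟨u * s, by rw [mul_smul, hu, smul_zero, smul_zero]⟩
  · rintro ⟨u, hu⟩
    exact ⟨u, by rw [smul_comm u s m, hu, smul_zero, smul_zero]⟩

lemma mem_powTorsion_localizedModule [IsNoetherianRing R] {M : Type*} [AddCommGroup M] [Module R M]
    (x : LocalizedModule S M) :
    x ∈ powTorsion (a.map (algebraMap R (Localization S))) (LocalizedModule S M) ↔
      ∃ m ∈ powTorsion a M, ∃ s, LocalizedModule.mk m s = x := by
  constructor
  · rintro ⟨k, hk⟩
    induction x using LocalizedModule.induction_on with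
    | h m s =>
    have h1 : ∀ r ∈ a ^ k, ∃ u : S, u • r • m = 0 := by
      intro r hr
      rw [← LocalizedModule.mk_eq_zero_iff S (s := s), ← LocalizedModule.smul'_mk,
        ← algebraMap_smul (Localization S)]
      refine hk _ ?_
      rw [← Ideal.map_pow]
      exact Ideal.mem_map_of_mem _ hr
    obtain ⟨t, ht⟩ := IsNoetherian.noetherian (a ^ k)
    choose! u hu using h1
    refine ⟨(∏ r ∈ t, u r) • m, ⟨k, fun r hr ↦ ?_⟩, (∏ r ∈ t, u r) * s,
      LocalizedModule.mk_cancel_common_left _ _ _⟩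
    rw [← ht] at hr
    induction hr using Submodule.span_induction with
    | mem r hr =>
      obtain ⟨c, hc⟩ := Finset.dvd_prod_of_mem u (Finset.mem_coe.mp hr)
      rw [hc, mul_comm, mul_smul, ← smul_comm c r, ← smul_comm (u r) r,
        hu r (ht ▸ Submodule.subset_span hr), smul_zero]
    | zero => exact zero_smul R _
    | add x y _ _ hx hy => rw [add_smul, hx, hy, add_zero]
    | smul c x _ hx => rw [smul_assoc, hx, smul_zero]
  · rintro ⟨m, ⟨k, hk⟩, s, rfl⟩
    refine ⟨k, fun r hr ↦ ?_⟩
    rw [← Ideal.map_pow] at hr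
    induction hr using Submodule.span_induction with
    | mem r hr =>
      obtain ⟨r, hr, rfl⟩ := hr
      rw [algebraMap_smul, LocalizedModule.smul'_mk, hk r hr, LocalizedModule.zero_mk]
    | zero => exact zero_smul _ _
    | add x y _ _ hx hy => rw [add_smul, hx, hy, add_zero]
    | smul c x _ hx => rw [smul_assoc, hx, smul_zero]

lemma nonempty_localizedModule_powTorsion_equiv [IsNoetherianRing R] (M : Type*) [AddCommGroup M]
    [Module R M] : Nonempty (LocalizedModule S (powTorsion a M) ≃ₗ[Localization S]
      powTorsion (a.map (algebraMap R (Localization S))) (LocalizedModule S M)) := by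
  let f := LocalizedModule.map S (powTorsion a M).subtype
  have hf : Function.Injective f :=
    IsLocalizedModule.map_injective S (LocalizedModule.mkLinearMap S _)
      (LocalizedModule.mkLinearMap S _) _ (Submodule.subtype_injective _)
  refine ⟨(LinearEquiv.ofInjective f hf).trans (LinearEquiv.ofEq _ _ ?_)⟩
  ext x
  rw [mem_powTorsion_localizedModule]
  constructor
  · rintro ⟨y, rfl⟩
    induction y using LocalizedModule.induction_on with
    | h m s => exact ⟨m, m.2, s, (LocalizedModule.map_mk S (powTorsion a M).subtype m s).symm⟩
  · rintro ⟨m, hm, s, rfl⟩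
    exact ⟨LocalizedModule.mk ⟨m, hm⟩ s, LocalizedModule.map_mk S (powTorsion a M).subtype ⟨m, hm⟩ s⟩

lemma nonempty_localizedModule_equiv {A B : Type*} [AddCommGroup A] [Module R A] [AddCommGroup B]
    [Module R B] (e : A ≃ₗ[R] B) :
    Nonempty (LocalizedModule S A ≃ₗ[Localization S] LocalizedModule S B) :=
  ⟨LinearEquiv.ofBijective (LocalizedModule.map S e.toLinearMap)
    ⟨IsLocalizedModule.map_injective S (LocalizedModule.mkLinearMap S _)
      (LocalizedModule.mkLinearMap S _) _ e.injective,
    IsLocalizedModule.map_surjective S (LocalizedModule.mkLinearMap S _)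
      (LocalizedModule.mkLinearMap S _) _ e.surjective⟩⟩

end Localization

section Shift
variable {R : Type u} [CommRing R] [IsNoetherianRing R] (a : Ideal R)
  {A B C : Type u} [AddCommGroup A] [AddCommGroup B] [AddCommGroup C] [Module R A] [Module R B]
  [Module R C] {f : A →ₗ[R] B} {g : B →ₗ[R] C}

namespace LocCoh

lemma nonempty_equiv_of_torsion (hf : Function.Injective f) (hfg : Function.Exact f g)
    (hg : Function.Surjective g) (hA : powTorsion a A = ⊤) (i : ℕ) :
    Nonempty (LocCoh a (i + 1) (.of R B) ≃ₗ[R] LocCoh a (i + 1) (.of R C)) := by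
  have hS := ModuleCat.shortComplex_shortExact
    (ModuleCat.shortComplexOfCompEqZero f g hfg.linearMap_comp_eq_zero) hfg hf hg
  have h (i) : Subsingleton (LocCoh a (i + 1) (.of R A)) := subsingleton_of_torsion a i (.of R A) hA
  refine ⟨LinearEquiv.ofBijective (map a (i + 1) (ModuleCat.ofHom g)) ⟨?_, fun x ↦
    (exact_map_δ a hS (i + 1) x).mp
      (Subsingleton.elim (α := LocCoh a (i + 1 + 1) (.of R A)) _ _)⟩⟩
  rw [injective_iff_map_eq_zero]
  intro x hx
  obtain ⟨y, rfl⟩ := (exact_map_map a hS (i + 1) x).mp hx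
  rw [Subsingleton.elim (α := LocCoh a (i + 1) (.of R A)) y 0, map_zero]

omit [IsNoetherianRing R] in
lemma subsingleton_of_torsionFree_injective [Module.Injective R B] (hB : powTorsion a B = ⊥)
    (i : ℕ) : Subsingleton (LocCoh a i (.of R B)) := by
  cases i with
  | zero =>
    have : Subsingleton (powTorsion a B) := by
      rw [hB]; infer_instance
    exact (zeroEquiv a (.of R B)).injective.subsingleton
  | succ i =>
    have := (Module.injective_iff_injective_object R B).mp inferInstance
    infer_instance

omit [IsNoetherianRing R] in
lemma nonempty_equiv_of_torsionFree_injective [Module.Injective R B] (hf : Function.Injective f)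
    (hfg : Function.Exact f g) (hg : Function.Surjective g) (hB : powTorsion a B = ⊥) (i : ℕ) :
    Nonempty (LocCoh a i (.of R C) ≃ₗ[R] LocCoh a (i + 1) (.of R A)) :=
  nonempty_equiv_of_subsingleton a (ModuleCat.shortComplex_shortExact
    (ModuleCat.shortComplexOfCompEqZero f g hfg.linearMap_comp_eq_zero) hfg hf hg) i
    (subsingleton_of_torsionFree_injective a hB i)
    (subsingleton_of_torsionFree_injective a hB (i + 1))

/-- Local cohomology commutes with localization. -/
theorem nonempty_localizedModule_equiv (S : Submonoid R) (i : ℕ) :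
    ∀ (M : Type u) [AddCommGroup M] [Module R M],
    Nonempty (LocalizedModule S (LocCoh a i (.of R M)) ≃ₗ[Localization S]
      LocCoh (a.map (algebraMap R (Localization S))) i
        (.of (Localization S) (LocalizedModule S M))) := by
  have hN : IsNoetherianRing (Localization S) := IsLocalization.isNoetherianRing S _ inferInstance
  induction i with
  | zero =>
    intro M _ _
    have ⟨e₁⟩ := _root_.nonempty_localizedModule_equiv S (zeroEquiv a (.of R M))
    have ⟨e₂⟩ := nonempty_localizedModule_powTorsion_equiv a S M
    exact ⟨e₁.trans (e₂.trans (zeroEquiv _ (.of _ (LocalizedModule S M))).symm)⟩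
  | succ i ih =>
    intro M _ _
    let N := powTorsion a M
    obtain ⟨E, f, hE, hf, hEt⟩ :=
      exists_torsionFree_injective_embedding a (powTorsion_quotient_eq_bot a M)
    let L {A B : Type u} [AddCommGroup A] [Module R A] [AddCommGroup B] [Module R B]
      (h : A →ₗ[R] B) := LocalizedModule.map S h
    have Linj {A B : Type u} [AddCommGroup A] [Module R A] [AddCommGroup B] [Module R B]
      {h : A →ₗ[R] B} (hh : Function.Injective h) : Function.Injective (L h) :=
      IsLocalizedModule.map_injective S (LocalizedModule.mkLinearMap S _)
        (LocalizedModule.mkLinearMap S _) _ hh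
    have Lsurj {A B : Type u} [AddCommGroup A] [Module R A] [AddCommGroup B] [Module R B]
      {h : A →ₗ[R] B} (hh : Function.Surjective h) : Function.Surjective (L h) :=
      IsLocalizedModule.map_surjective S (LocalizedModule.mkLinearMap S _)
        (LocalizedModule.mkLinearMap S _) _ hh
    have Lex {A B C : Type u} [AddCommGroup A] [Module R A] [AddCommGroup B] [Module R B]
      [AddCommGroup C] [Module R C] {g : A →ₗ[R] B} {h : B →ₗ[R] C} (hh : Function.Exact g h) :
      Function.Exact (L g) (L h) := LocalizedModule.map_exact S g h hh
    have hNex : Function.Exact N.subtype N.mkQ := LinearMap.exact_subtype_mkQ N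
    have hfex : Function.Exact f (LinearMap.range f).mkQ := LinearMap.exact_map_mkQ_range f
    have hNt : powTorsion (a.map (algebraMap R (Localization S))) (LocalizedModule S N) = ⊤ := by
      rw [eq_top_iff]
      rintro x -
      rw [mem_powTorsion_localizedModule]
      induction x using LocalizedModule.induction_on with
      | h m s => exact ⟨m, powTorsion_powTorsion a M ▸ Submodule.mem_top, s, rfl⟩
    have hEt' : powTorsion (a.map (algebraMap R (Localization S))) (LocalizedModule S E) = ⊥ := by
      rw [eq_bot_iff]
      intro x hx
      obtain ⟨m, hm, s, rfl⟩ := (mem_powTorsion_localizedModule a S x).mp hx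
      rw [hEt] at hm
      rw [(Submodule.mem_bot R).mp hm]
      exact LocalizedModule.zero_mk s
    have : Module.Injective (Localization S) (LocalizedModule S E) :=
      Module.injective_of_isLocalizedModule S (LocalizedModule.mkLinearMap S E)
    have ⟨e₁⟩ := nonempty_equiv_of_torsion a N.subtype_injective hNex N.mkQ_surjective
      (powTorsion_powTorsion a M) i
    have ⟨e₂⟩ := nonempty_equiv_of_torsionFree_injective a hf hfex
      (Submodule.mkQ_surjective _) hEt i
    have ⟨e₃⟩ := ih (E ⧸ LinearMap.range f)
    have ⟨e₄⟩ := nonempty_equiv_of_torsionFree_injective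
      (a.map (algebraMap R (Localization S))) (Linj hf) (Lex hfex)
      (Lsurj (Submodule.mkQ_surjective _)) hEt' i
    have ⟨e₅⟩ := nonempty_equiv_of_torsion (a.map (algebraMap R (Localization S)))
      (Linj N.subtype_injective) (Lex hNex) (Lsurj N.mkQ_surjective) hNt i
    have ⟨e₆⟩ := _root_.nonempty_localizedModule_equiv S (e₁.trans e₂.symm)
    exact ⟨e₆.trans (e₃.trans (e₄.trans e₅.symm))⟩

end LocCoh
end Shift

section Finiteness
variable {R : Type u} [CommRing R] [IsNoetherianRing R] (a : Ideal R)

lemma isAssociatedPrime_iff_exists_smul {N : Type*} [AddCommGroup N] [Module R N] {p : Ideal R} :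
    IsAssociatedPrime p N ↔ p.IsPrime ∧ ∃ x : N, ∀ r, r ∈ p ↔ r • x = 0 := by
  rw [isAssociatedPrime_iff]
  simp only [SetLike.ext_iff, Submodule.mem_colon_singleton, Submodule.mem_bot]

lemma associatedPrimes_finite_of_finite_torsionBySet {N : Type*} [AddCommGroup N] [Module R N]
    (hN : powTorsion a N = ⊤)
    [Module.Finite R (Submodule.torsionBySet R N a)] :
    (associatedPrimes R N).Finite ∧ ∀ p ∈ associatedPrimes R N, a ≤ p := by
  have hle : ∀ p ∈ associatedPrimes R N, a ≤ p := by
    intro p hp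
    obtain ⟨hp', x, hx⟩ := isAssociatedPrime_iff_exists_smul.mp hp
    obtain ⟨k, hk⟩ := hN.ge (Submodule.mem_top (x := x))
    exact hp'.le_of_pow_le fun r hr ↦ (hx r).mpr (hk r hr)
  refine ⟨(associatedPrimes.finite R (Submodule.torsionBySet R N a)).subset fun p hp ↦ ?_, hle⟩
  obtain ⟨hp', x, hx⟩ := isAssociatedPrime_iff_exists_smul.mp hp
  refine isAssociatedPrime_iff_exists_smul.mpr ⟨hp', ⟨x, ?_⟩, fun r ↦ ?_⟩
  · rw [Submodule.mem_torsionBySet_iff]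
    exact fun r ↦ (hx r).mp (hle p hp r.2)
  · rw [hx, Subtype.ext_iff]
    rfl

/-- An `a`-torsion module all of whose localizations at associated primes are finite is killed by
a power of `a`, provided it has finitely many associated primes. -/
lemma exists_pow_smul_eq_zero_of_finite_localizedModule {N : Type*} [AddCommGroup N] [Module R N]
    (hN : powTorsion a N = ⊤) (hfin : (associatedPrimes R N).Finite)
    (h : ∀ p : PrimeSpectrum R, p.asIdeal ∈ associatedPrimes R N →
      Module.Finite (Localization.AtPrime p.asIdeal) (LocalizedModule p.asIdeal.primeCompl N)) :
    ∃ k, ∀ r ∈ a ^ k, ∀ x : N, r • x = 0 := by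
  have h1 : ∀ p ∈ associatedPrimes R N, ∃ k, ∀ r ∈ a ^ k, ∀ x : N, ∃ u ∉ p, u • r • x = 0 := by
    intro p hp
    have hp' : p.IsPrime := IsAssociatedPrime.isPrime hp
    have := h ⟨p, hp'⟩ hp
    obtain ⟨k, hk⟩ := (Module.Finite.fg_top (R := Localization.AtPrime p)
      (M := LocalizedModule p.primeCompl N)).exists_pow_smul_eq_zero
      (a.map (algebraMap R (Localization p.primeCompl))) fun x _ ↦ by
        rw [mem_powTorsion_localizedModule]
        induction x using LocalizedModule.induction_on with
        | h m s => exact ⟨m, hN ▸ Submodule.mem_top, s, rfl⟩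
    refine ⟨k, fun r hr x ↦ ?_⟩
    have h2 : LocalizedModule.mk (r • x) (1 : p.primeCompl) = 0 := by
      rw [← LocalizedModule.smul'_mk, ← algebraMap_smul (Localization p.primeCompl)]
      refine hk _ ?_ _ Submodule.mem_top
      rw [← Ideal.map_pow]
      exact Ideal.mem_map_of_mem _ hr
    obtain ⟨u, hu⟩ := (LocalizedModule.mk_eq_zero_iff _).mp h2
    exact ⟨u, u.2, hu⟩
  choose! k hk using h1
  refine ⟨hfin.toFinset.sup k, fun r hr x ↦ ?_⟩
  by_contra hne
  obtain ⟨p, hp, hle⟩ := exists_le_isAssociatedPrime_of_isNoetherianRing R _ hne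
  obtain ⟨u, hup, hu⟩ := hk p hp r
    (Ideal.pow_le_pow_right (Finset.le_sup (hfin.mem_toFinset.mpr hp)) hr) x
  exact hup (hle (Submodule.mem_colon_singleton.mpr hu))

namespace LocCoh

omit [IsNoetherianRing R] in
lemma powTorsion_eq_top (i : ℕ) (M : ModuleCat.{u} R) : powTorsion a (LocCoh a i M) = ⊤ :=
  eq_top_iff.mpr fun z _ ↦ exists_pow_smul_eq_zero a i M z

omit [IsNoetherianRing R] in
lemma subsingleton_of_subsingleton (i : ℕ) (M : Type u) [AddCommGroup M] [Module R M]
    [Subsingleton M] : Subsingleton (LocCoh a i (.of R M)) := by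
  have : Module.Injective R M := ⟨fun _ _ _ _ _ _ _ _ _ ↦ ⟨0, fun _ ↦ Subsingleton.elim _ _⟩⟩
  exact subsingleton_of_torsionFree_injective a (Subsingleton.elim _ _) i

/-- Faltings' local-global principle for the finiteness of local cohomology. -/
theorem finite_of_forall_finite_localizedModule (M : Type u) [AddCommGroup M] [Module R M]
    [Module.Finite R M] (t : ℕ)
    (h : ∀ p ∈ Module.support R (M ⧸ (a • ⊤ : Submodule R M)), ∀ i < t,
      Module.Finite (Localization.AtPrime p.asIdeal)
        (LocCoh (a.map (algebraMap R (Localization.AtPrime p.asIdeal))) i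
          (.of (Localization.AtPrime p.asIdeal) (LocalizedModule p.asIdeal.primeCompl M))))
    (s : ℕ) (hs : s < t) : Module.Finite R (LocCoh a s (.of R M)) := by
  induction s using Nat.strong_induction_on with
  | h s ih =>
  have hT (k : ℕ) : Module.Finite R
      (Submodule.torsionBySet R (LocCoh a s (.of R M)) (a ^ k : Ideal R)) :=
    finite_torsionBySet a k s (.of R M) (fun j ↦ inferInstance) fun i hi ↦ ih i hi (hi.trans hs)
  have hN := powTorsion_eq_top a s (.of R M)
  have := hT 1
  rw [pow_one] at this
  obtain ⟨hfin, hle⟩ := associatedPrimes_finite_of_finite_torsionBySet a hN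
  obtain ⟨k, hk⟩ := exists_pow_smul_eq_zero_of_finite_localizedModule a hN hfin fun p hp ↦ by
    have ⟨e⟩ := nonempty_localizedModule_equiv a p.asIdeal.primeCompl s M
    have hpM : p ∈ Module.support R M := by
      by_contra hp'
      rw [Module.notMem_support_iff] at hp'
      have := subsingleton_of_subsingleton
        (a.map (algebraMap R (Localization p.asIdeal.primeCompl))) s
        (LocalizedModule p.asIdeal.primeCompl M)
      have hsub := e.injective.subsingleton
      rw [← Module.notMem_support_iff] at hsub
      obtain ⟨_, x, hx⟩ := isAssociatedPrime_iff_exists_smul.mp hp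
      exact hsub (Module.mem_support_iff'.mpr ⟨x, fun r hr h0 ↦ hr ((hx r).mpr h0)⟩)
    have := h p (by
      rw [Module.support_quotient]
      exact ⟨hpM, hle _ hp⟩) s hs
    exact Module.Finite.equiv e.symm
  have htop : Submodule.torsionBySet R (LocCoh a s (.of R M)) (a ^ k : Ideal R) = ⊤ := by
    rw [eq_top_iff]
    intro x _
    rw [Submodule.mem_torsionBySet_iff]
    exact fun r ↦ hk r r.2 x
  have := hT k
  rw [htop] at this
  exact Module.Finite.equiv Submodule.topEquiv

end LocCoh

lemma finite_localCohomology_iff {R : Type u} [CommRing R] [IsNoetherianRing R] (a : Ideal R)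
    (i : ℕ) (M : ModuleCat.{u} R) :
    Module.Finite R ((localCohomology a i).obj M) ↔ Module.Finite R (LocCoh a i M) :=
  have ⟨e⟩ := nonempty_localCohomology_equiv a i M
  Module.Finite.equiv_iff e

end Finiteness

theorem fDimN_zero_eq_fDim (R M : Type u) [CommRing R] [IsNoetherianRing R]
    [AddCommGroup M] [Module R M] [Module.Finite R M] (a : Ideal R) :
    fDimN R a M 0 = fDim R a M := by
  refine le_antisymm (le_sInf ?_) (le_sInf ?_)
  · rintro _ ⟨j, rfl, hj⟩
    by_contra! hlt
    refine hj ((finite_localCohomology_iff a j _).mpr ?_)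
    refine LocCoh.finite_of_forall_finite_localizedModule a M (j + 1) (fun p hp i hi ↦ ?_) j
      j.lt_succ_self
    by_contra hfin
    have : IsNoetherianRing (Localization.AtPrime p.asIdeal) :=
      IsLocalization.isNoetherianRing p.asIdeal.primeCompl _ inferInstance
    rw [← finite_localCohomology_iff] at hfin
    have : Nontrivial (R ⧸ p.asIdeal) := Ideal.Quotient.nontrivial_iff.mpr p.2.ne_top
    have hle : fDimN R a M 0 ≤ fDim (Localization.AtPrime p.asIdeal)
        (a.map (algebraMap R (Localization.AtPrime p.asIdeal)))
        (LocalizedModule p.asIdeal.primeCompl M) :=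
      sInf_le ⟨p, hp, by simpa using ringKrullDim_nonneg_of_nontrivial (R := R ⧸ p.asIdeal), rfl⟩
    have hle' : fDim (Localization.AtPrime p.asIdeal)
        (a.map (algebraMap R (Localization.AtPrime p.asIdeal)))
        (LocalizedModule p.asIdeal.primeCompl M) ≤ i :=
      sInf_le ⟨i, rfl, hfin⟩
    exact hlt.not_ge ((hle.trans hle').trans (by exact_mod_cast Nat.le_of_lt_succ hi))
  · rintro _ ⟨p, hp, -, rfl⟩
    refine le_sInf ?_
    rintro _ ⟨j, rfl, hj⟩
    refine sInf_le ⟨j, rfl, fun hfin ↦ hj ?_⟩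
    have : IsNoetherianRing (Localization.AtPrime p.asIdeal) :=
      IsLocalization.isNoetherianRing p.asIdeal.primeCompl _ inferInstance
    rw [finite_localCohomology_iff] at hfin ⊢
    have ⟨e⟩ := LocCoh.nonempty_localizedModule_equiv a p.asIdeal.primeCompl j M
    have : Module.Finite (Localization p.asIdeal.primeCompl)
        (LocalizedModule p.asIdeal.primeCompl (LocCoh a j (.of R M))) :=
      Module.Finite.of_isLocalizedModule p.asIdeal.primeCompl
        (LocalizedModule.mkLinearMap p.asIdeal.primeCompl (LocCoh a j (.of R M)))
    exact Module.Finite.equiv e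
end
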